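/- arXiv:2211.12697 — 8 statements merged into one kernel-verified Lean document; each statement's English description precedes it below -/
import Mathlib

section
/- Let a, b be real numbers with a > b > 0, let μ ∈ [0,1], and let z ∈ ℂ with |z| < b. Then μ Re(z/(a − z)) − Re(z/(b − z)) ≥ μ |z|/(a − |z|) − |z|/(b − |z|). -/
lemma re_div_ofReal_sub (a : ℝ) (z : ℂ) :
    (z / ((a : ℂ) - z)).re = (a * z.re - ‖z‖ ^ 2) / (a ^ 2 - 2 * a * z.re + ‖z‖ ^ 2) := by
  have hn : ‖z‖ ^ 2 = z.re * z.re + z.im * z.im := by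
    rw [← Complex.normSq_eq_norm_sq, Complex.normSq_apply]
  have hD : Complex.normSq ((a : ℂ) - z) = a ^ 2 - 2 * a * z.re + ‖z‖ ^ 2 := by
    rw [hn, Complex.normSq_apply]
    simp only [Complex.sub_re, Complex.sub_im, Complex.ofReal_re, Complex.ofReal_im]
    ring
  rw [Complex.div_re, hD, ← add_div, hn]
  simp only [Complex.sub_re, Complex.sub_im, Complex.ofReal_re, Complex.ofReal_im]
  ring

lemma sq_sub_two_mul_add_sq_pos {a r x : ℝ} (hr : 0 ≤ r) (ha : r < a) (hx : x ≤ r) :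
    0 < a ^ 2 - 2 * a * x + r ^ 2 := by
  nlinarith [mul_nonneg (hr.trans ha.le) (sub_nonneg.2 hx), pow_pos (sub_pos.2 ha) 2]

lemma div_sub_sub_div_eq {a r x : ℝ} (hr : 0 ≤ r) (ha : r < a) (hx : x ≤ r) :
    r / (a - r) - (a * x - r ^ 2) / (a ^ 2 - 2 * a * x + r ^ 2) =
      (a + r) / (a - r) * (a / (a ^ 2 - 2 * a * x + r ^ 2)) * (r - x) := by
  have h₁ : a - r ≠ 0 := (sub_pos.2 ha).ne'
  have h₂ := (sq_sub_two_mul_add_sq_pos hr ha hx).ne'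
  rw [div_sub_div _ _ h₁ h₂, div_mul_div_comm, div_mul_eq_mul_div]
  congr 1
  ring

theorem stmt_6 (a b : ℝ) (hab : b < a) (hb : 0 < b) (μ : ℝ) (hμ : μ ∈ Set.Icc (0 : ℝ) 1)
    (z : ℂ) (hz : ‖z‖ < b) :
    μ * ‖z‖ / (a - ‖z‖) - ‖z‖ / (b - ‖z‖) ≤
      μ * (z / ((a : ℂ) - z)).re - (z / ((b : ℂ) - z)).re := by
  rw [re_div_ofReal_sub, re_div_ofReal_sub, mul_div_assoc]
  have hx : z.re ≤ ‖z‖ := Complex.re_le_norm z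
  have hr : 0 ≤ ‖z‖ := norm_nonneg z
  generalize ‖z‖ = r at *
  generalize z.re = x at *
  have hra : r < a := hz.trans hab
  have ha : 0 < a := hb.trans hab
  have hDa := sq_sub_two_mul_add_sq_pos hr hra hx
  have hDb := sq_sub_two_mul_add_sq_pos hr hz hx
  have hEa := div_sub_sub_div_eq hr hra hx
  have hEb := div_sub_sub_div_eq hr hz hx
  have har : 0 < a - r := sub_pos.2 hra
  have hbr : 0 < b - r := sub_pos.2 hz
  have hxr : 0 ≤ r - x := sub_nonneg.2 hx
  have h₁ : (a + r) / (a - r) ≤ (b + r) / (b - r) := by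
    rw [div_le_div_iff₀ har hbr]
    nlinarith [mul_nonneg hr (sub_nonneg.2 hab.le)]
  have h₂ : a / (a ^ 2 - 2 * a * x + r ^ 2) ≤ b / (b ^ 2 - 2 * b * x + r ^ 2) := by
    rw [div_le_div_iff₀ hDa hDb]
    have hab_r : 0 ≤ a * b - r ^ 2 := by nlinarith
    nlinarith [mul_nonneg hab_r (sub_nonneg.2 hab.le)]
  have hmono : (a + r) / (a - r) * (a / (a ^ 2 - 2 * a * x + r ^ 2)) * (r - x) ≤
      (b + r) / (b - r) * (b / (b ^ 2 - 2 * b * x + r ^ 2)) * (r - x) := by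
    gcongr
  have hnonneg : 0 ≤ (a + r) / (a - r) * (a / (a ^ 2 - 2 * a * x + r ^ 2)) * (r - x) := by
    positivity
  have hμmul := mul_le_of_le_one_left hnonneg hμ.2
  rw [← hEa] at hμmul hmono
  rw [← hEb] at hmono
  linarith
end

section
/- (Theorem 1(a)) Let ν > 0, α ∈ [0,1), γ ∈ (−π/2, π/2). Then there is a unique r* ∈ (0, λ_0) such that 1 + r* Ψ'(r*)/(ν Ψ(r*)) = 1 − (1−α) cos γ, and for every z ∈ ℂ with |z| < r* one has Re( e^{−iγ} (1 + z Ψ'(z)/(ν Ψ(z))) ) > α cos γ. (For the normalization f_ν(z) = [2^ν Γ(ν+1) N_ν(z)/Q(ν)]^{1/ν} of the Bessel-derivative function N_ν, the quantity 1 + zΨ'(z)/(νΨ(z)) equals z f_ν'(z)/f_ν(z), so r* is the radius of γ-spirallikeness of order α of f_ν.) -/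
open Real

/-- The entire function `Ψ(z) = ∏_{n≥0} (1 − z²/λ_n²)`. -/
noncomputable def PsiProd (l : ℕ → ℝ) (z : ℂ) : ℂ :=
  ∏' n : ℕ, (1 - z ^ 2 / ((l n : ℂ)) ^ 2)

/-- The real series `∑ 2t²/(λ_n² − t²)`, which equals `-tΨ'(t)/Ψ(t)` on `[0, λ_0)`. -/
noncomputable def psiSum (l : ℕ → ℝ) (t : ℝ) : ℝ :=
  ∑' n : ℕ, 2 * t ^ 2 / (l n ^ 2 - t ^ 2)

lemma sq_lt_sq_of_lt_zero_index {l : ℕ → ℝ} (hmono : StrictMono l) {t : ℝ} (ht : 0 ≤ t)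
    (htl : t < l 0) (n : ℕ) : t ^ 2 < l n ^ 2 :=
  pow_lt_pow_left₀ (htl.trans_le (hmono.monotone n.zero_le)) ht two_ne_zero

lemma summable_psiSum {l : ℕ → ℝ} (hmono : StrictMono l) (hpos : ∀ n, 0 < l n)
    (hsum : Summable fun n => 1 / (l n) ^ 2) {t : ℝ} (ht : 0 ≤ t) (htl : t < l 0) :
    Summable fun n => 2 * t ^ 2 / (l n ^ 2 - t ^ 2) := by
  have h0 := sq_lt_sq_of_lt_zero_index hmono ht htl
  refine Summable.of_nonneg_of_le
    (fun n => div_nonneg (by positivity) (sub_nonneg.2 (h0 n).le)) (fun n => ?_)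
    (hsum.mul_left (2 * t ^ 2 * (l 0 ^ 2 / (l 0 ^ 2 - t ^ 2))))
  have hp0 := hpos 0
  have hpn := hpos n
  have hle : l 0 ^ 2 ≤ l n ^ 2 := pow_le_pow_left₀ hp0.le (hmono.monotone n.zero_le) 2
  have h1 : 0 < l 0 ^ 2 - t ^ 2 := sub_pos.2 (h0 0)
  have h2 : 0 < l n ^ 2 - t ^ 2 := sub_pos.2 (h0 n)
  have : 2 * t ^ 2 * (l 0 ^ 2 / (l 0 ^ 2 - t ^ 2)) * (1 / l n ^ 2)
      = 2 * t ^ 2 * l 0 ^ 2 / ((l 0 ^ 2 - t ^ 2) * l n ^ 2) := by field_simp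
  rw [this, div_le_div_iff₀ h2 (by positivity), mul_assoc]
  nlinarith [mul_nonneg (sq_nonneg t) (mul_nonneg (sq_nonneg t) (sub_nonneg.2 hle))]

lemma psiSum_term_mono {a s t : ℝ} (hs : 0 ≤ s) (hst : s ≤ t) (hta : t ^ 2 < a) :
    2 * s ^ 2 / (a - s ^ 2) ≤ 2 * t ^ 2 / (a - t ^ 2) := by
  have h : s ^ 2 ≤ t ^ 2 := pow_le_pow_left₀ hs hst 2
  exact div_le_div₀ (by positivity) (by linarith) (by linarith) (by linarith)

lemma psiSum_strictMonoOn {l : ℕ → ℝ} (hmono : StrictMono l) (hpos : ∀ n, 0 < l n)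
    (hsum : Summable fun n => 1 / (l n) ^ 2) : StrictMonoOn (psiSum l) (Set.Ico 0 (l 0)) := by
  intro s hs t ht hst
  have h0 := sq_lt_sq_of_lt_zero_index hmono ht.1 ht.2
  refine Summable.tsum_lt_tsum (i := 0) (fun n => psiSum_term_mono hs.1 hst.le (h0 n)) ?_
    (summable_psiSum hmono hpos hsum hs.1 hs.2) (summable_psiSum hmono hpos hsum ht.1 ht.2)
  have h : s ^ 2 < t ^ 2 := pow_lt_pow_left₀ hst hs.1 two_ne_zero
  have := h0 0
  rw [div_lt_div_iff₀ (by linarith) (by linarith)]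
  nlinarith [mul_pos (sub_pos.2 h) (pow_pos (hpos 0) 2)]

lemma continuousOn_psiSum {l : ℕ → ℝ} (hmono : StrictMono l) (hpos : ∀ n, 0 < l n)
    (hsum : Summable fun n => 1 / (l n) ^ 2) {t : ℝ} (ht : 0 ≤ t) (htl : t < l 0) :
    ContinuousOn (psiSum l) (Set.Icc 0 t) := by
  have h0 := sq_lt_sq_of_lt_zero_index hmono ht htl
  have hx : ∀ n, ∀ x ∈ Set.Icc 0 t, 0 < l n ^ 2 - x ^ 2 := fun n x hx =>
    sub_pos.2 ((pow_le_pow_left₀ hx.1 hx.2 2).trans_lt (h0 n))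
  refine continuousOn_tsum (fun n => ContinuousOn.div (by fun_prop) (by fun_prop)
    fun x h => (hx n x h).ne') (summable_psiSum hmono hpos hsum ht htl) fun n x h => ?_
  rw [Real.norm_of_nonneg (div_nonneg (by positivity) (hx n x h).le)]
  exact psiSum_term_mono h.1 h.2 (h0 n)

lemma exists_psiSum_eq {l : ℕ → ℝ} (hmono : StrictMono l) (hpos : ∀ n, 0 < l n)
    (hsum : Summable fun n => 1 / (l n) ^ 2) {c : ℝ} (hc : 0 < c) :
    ∃ r ∈ Set.Ioo 0 (l 0), psiSum l r = c := by
  have hp0 := hpos 0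
  obtain ⟨t, ht, hteq⟩ : ∃ t, 0 ≤ t ∧ t ^ 2 = l 0 ^ 2 * (c / (c + 2)) :=
    ⟨√(l 0 ^ 2 * (c / (c + 2))), Real.sqrt_nonneg _, Real.sq_sqrt (by positivity)⟩
  have hlt : c / (c + 2) < 1 := by rw [div_lt_one (by linarith)]; linarith
  have htl : t < l 0 := by
    refine lt_of_pow_lt_pow_left₀ 2 hp0.le ?_
    rw [hteq]
    exact mul_lt_of_lt_one_right (by positivity) hlt
  have h0 := sq_lt_sq_of_lt_zero_index hmono ht htl
  have hterm : 2 * t ^ 2 / (l 0 ^ 2 - t ^ 2) = c := by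
    rw [div_eq_iff (sub_pos.2 (h0 0)).ne', hteq]
    field_simp
    ring
  have hbig : c ≤ psiSum l t := by
    have := (summable_psiSum hmono hpos hsum ht htl).le_tsum 0 fun n _ =>
      div_nonneg (by positivity) (sub_nonneg.2 (h0 n).le)
    rwa [hterm] at this
  have hzero : psiSum l 0 = 0 := by simp [psiSum]
  obtain ⟨r, hr, hrc⟩ := intermediate_value_Icc ht (continuousOn_psiSum hmono hpos hsum ht htl)
    (show c ∈ Set.Icc (psiSum l 0) (psiSum l t) from ⟨by rw [hzero]; exact hc.le, hbig⟩)
  refine ⟨r, ⟨lt_of_le_of_ne hr.1 ?_, hr.2.trans_lt htl⟩, hrc⟩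
  rintro rfl
  rw [hzero] at hrc
  exact hc.ne hrc

lemma norm_psi_term_le {a t : ℝ} {z : ℂ} (hz : ‖z‖ = t) (hta : t ^ 2 < a) :
    ‖2 * z ^ 2 / ((a : ℂ) - z ^ 2)‖ ≤ 2 * t ^ 2 / (a - t ^ 2) := by
  have hlow : a - t ^ 2 ≤ ‖(a : ℂ) - z ^ 2‖ := by
    have := norm_sub_norm_le (a : ℂ) (z ^ 2)
    rw [norm_pow, hz, Complex.norm_of_nonneg ((sq_nonneg t).trans hta.le)] at this
    exact this
  rw [norm_div, norm_mul, norm_pow, hz, Complex.norm_ofNat]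
  exact div_le_div_of_nonneg_left (by positivity) (sub_pos.2 hta) hlow

lemma sq_sub_sq_ne_zero {a : ℝ} {z : ℂ} (hza : ‖z‖ ^ 2 < a ^ 2) : (a : ℂ) ^ 2 - z ^ 2 ≠ 0 := by
  intro h
  have := congrArg norm (sub_eq_zero.1 h)
  rw [norm_pow, norm_pow, Complex.norm_real, Real.norm_eq_abs, sq_abs] at this
  exact hza.ne' this

lemma mul_logDeriv_one_sub_sq_div {a : ℝ} (ha : 0 < a) {z : ℂ} (hza : ‖z‖ ^ 2 < a ^ 2) :
    z * logDeriv (fun w : ℂ => 1 - w ^ 2 / (a : ℂ) ^ 2) z =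
      -(2 * z ^ 2 / ((a : ℂ) ^ 2 - z ^ 2)) := by
  have hd : HasDerivAt (fun w : ℂ => 1 - w ^ 2 / (a : ℂ) ^ 2) (-(2 * z / (a : ℂ) ^ 2)) z := by
    simpa using ((hasDerivAt_pow 2 z).div_const ((a : ℂ) ^ 2)).const_sub 1
  have hne := sq_sub_sq_ne_zero hza
  have ha' : (a : ℂ) ≠ 0 := by exact_mod_cast ha.ne'
  have h1 : 1 - z ^ 2 / (a : ℂ) ^ 2 = ((a : ℂ) ^ 2 - z ^ 2) / (a : ℂ) ^ 2 := by field_simp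
  rw [logDeriv_apply, hd.deriv, h1]
  field_simp

lemma mul_deriv_PsiProd_div {l : ℕ → ℝ} (hmono : StrictMono l) (hpos : ∀ n, 0 < l n)
    (hsum : Summable fun n => 1 / (l n) ^ 2) {z : ℂ} (hz : ‖z‖ < l 0) :
    z * deriv (PsiProd l) z / PsiProd l z =
      -∑' n, 2 * z ^ 2 / ((l n : ℂ) ^ 2 - z ^ 2) := by
  rcases eq_or_ne z 0 with rfl | hz0
  · simp
  have h0 := sq_lt_sq_of_lt_zero_index hmono (norm_nonneg z) hz
  have hl : ∀ n, (l n : ℂ) ≠ 0 := fun n => by exact_mod_cast (hpos n).ne'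
  have hnorm : ∀ n (w : ℂ), ‖-(w ^ 2 / (l n : ℂ) ^ 2)‖ = ‖w‖ ^ 2 * (1 / l n ^ 2) := by
    intro n w
    rw [norm_neg, norm_div, norm_pow, norm_pow, Complex.norm_of_nonneg (hpos n).le, mul_one_div]
  have hfac : ∀ n, 1 - z ^ 2 / (l n : ℂ) ^ 2 ≠ 0 := fun n => by
    rw [show 1 - z ^ 2 / (l n : ℂ) ^ 2 = ((l n : ℂ) ^ 2 - z ^ 2) / (l n : ℂ) ^ 2 by
      have := hl n; field_simp]
    exact div_ne_zero (sq_sub_sq_ne_zero (h0 n)) (pow_ne_zero 2 (hl n))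
  have hS : Summable fun n => -(2 * z ^ 2 / ((l n : ℂ) ^ 2 - z ^ 2)) := by
    refine (Summable.of_norm_bounded (summable_psiSum hmono hpos hsum (norm_nonneg z) hz)
      fun n => ?_).neg
    simpa using norm_psi_term_le (a := l n ^ 2) rfl (h0 n)
  have hterm : ∀ n, logDeriv (fun w : ℂ => 1 - w ^ 2 / (l n : ℂ) ^ 2) z =
      z⁻¹ * -(2 * z ^ 2 / ((l n : ℂ) ^ 2 - z ^ 2)) := fun n => by
    rw [← mul_logDeriv_one_sub_sq_div (hpos n) (h0 n), inv_mul_cancel_left₀ hz0]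
  have hmult : MultipliableLocallyUniformlyOn (fun n (w : ℂ) => 1 - w ^ 2 / (l n : ℂ) ^ 2)
      (Metric.ball 0 (l 0)) := by
    simp only [sub_eq_add_neg]
    refine Summable.multipliableLocallyUniformlyOn_nat_one_add Metric.isOpen_ball
      (hsum.mul_left (l 0 ^ 2)) (.of_forall fun n w hw => ?_) fun n => by fun_prop
    rw [hnorm]
    have : ‖w‖ ≤ l 0 := (mem_ball_zero_iff.1 hw).le
    gcongr
  have hprod : ∏' n, (1 - z ^ 2 / (l n : ℂ) ^ 2) ≠ 0 := by
    simp only [sub_eq_add_neg]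
    refine tprod_one_add_ne_zero_of_summable (fun n => by simpa [sub_eq_add_neg] using hfac n) ?_
    simp only [hnorm]
    exact hsum.mul_left _
  have key := logDeriv_tprod_eq_tsum Metric.isOpen_ball (mem_ball_zero_iff.2 hz) hfac
    (fun n => by fun_prop) (by simpa only [hterm] using hS.mul_left z⁻¹) hmult hprod
  simp only [hterm, tsum_mul_left, tsum_neg] at key
  rw [mul_div_assoc]
  change z * logDeriv (fun w => ∏' n, (1 - w ^ 2 / (l n : ℂ) ^ 2)) z = _
  rw [key, mul_inv_cancel_left₀ hz0]

lemma one_add_mul_deriv_PsiProd_div {l : ℕ → ℝ} (hmono : StrictMono l) (hpos : ∀ n, 0 < l n)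
    (hsum : Summable fun n => 1 / (l n) ^ 2) (ν : ℝ) {z : ℂ} (hz : ‖z‖ < l 0) :
    1 + z * deriv (PsiProd l) z / ((ν : ℂ) * PsiProd l z) =
      1 - (∑' n, 2 * z ^ 2 / ((l n : ℂ) ^ 2 - z ^ 2)) / ν := by
  rw [mul_comm (ν : ℂ), ← div_div, mul_deriv_PsiProd_div hmono hpos hsum hz, neg_div,
    ← sub_eq_add_neg]

lemma one_add_mul_deriv_PsiProd_div_ofReal {l : ℕ → ℝ} (hmono : StrictMono l)
    (hpos : ∀ n, 0 < l n) (hsum : Summable fun n => 1 / (l n) ^ 2) (ν : ℝ) {s : ℝ}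
    (hs : s ∈ Set.Ioo 0 (l 0)) :
    1 + (s : ℂ) * deriv (PsiProd l) s / ((ν : ℂ) * PsiProd l s) =
      ((1 - psiSum l s / ν : ℝ) : ℂ) := by
  rw [one_add_mul_deriv_PsiProd_div hmono hpos hsum ν
    (by rw [Complex.norm_of_nonneg hs.1.le]; exact hs.2), psiSum]
  push_cast
  rfl

lemma norm_tsum_le_psiSum {l : ℕ → ℝ} (hmono : StrictMono l) (hpos : ∀ n, 0 < l n)
    (hsum : Summable fun n => 1 / (l n) ^ 2) {z : ℂ} (hz : ‖z‖ < l 0) :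
    ‖∑' n, 2 * z ^ 2 / ((l n : ℂ) ^ 2 - z ^ 2)‖ ≤ psiSum l ‖z‖ :=
  tsum_of_norm_bounded (summable_psiSum hmono hpos hsum (norm_nonneg z) hz).hasSum fun n => by
    simpa using norm_psi_term_le (a := l n ^ 2) rfl
      (sq_lt_sq_of_lt_zero_index hmono (norm_nonneg z) hz n)

lemma cos_sub_norm_le_re_exp_mul (γ : ℝ) (w : ℂ) :
    Real.cos γ - ‖w‖ ≤ (Complex.exp (-Complex.I * (γ : ℂ)) * (1 - w)).re := by
  have he : Complex.exp (-Complex.I * (γ : ℂ)) = Complex.exp (((-γ : ℝ) : ℂ) * Complex.I) := by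
    push_cast; ring_nf
  have h := Complex.re_le_norm (Complex.exp (((-γ : ℝ) : ℂ) * Complex.I) * w)
  rw [norm_mul, Complex.norm_exp_ofReal_mul_I, one_mul] at h
  rw [he, mul_sub, mul_one, Complex.sub_re, Complex.exp_ofReal_mul_I_re, Real.cos_neg]
  linarith

theorem stmt_9 (l : ℕ → ℝ) (hmono : StrictMono l) (hpos : ∀ n, 0 < l n)
    (hsum : Summable fun n => 1 / (l n) ^ 2) (ν α γ : ℝ) (hν : 0 < ν)
    (hα : α ∈ Set.Ico (0 : ℝ) 1) (hγ : γ ∈ Set.Ioo (-(π / 2)) (π / 2)) :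
    ∃ r : ℝ, r ∈ Set.Ioo 0 (l 0) ∧
      ((1 : ℂ) + (r : ℂ) * deriv (PsiProd l) r / ((ν : ℂ) * PsiProd l r) =
        ((1 - (1 - α) * Real.cos γ : ℝ) : ℂ)) ∧
      (∀ s ∈ Set.Ioo (0 : ℝ) (l 0),
        ((1 : ℂ) + (s : ℂ) * deriv (PsiProd l) s / ((ν : ℂ) * PsiProd l s) =
          ((1 - (1 - α) * Real.cos γ : ℝ) : ℂ)) → s = r) ∧
      ∀ z : ℂ, ‖z‖ < r →
        α * Real.cos γ <
          (Complex.exp (-Complex.I * (γ : ℂ)) *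
            (1 + z * deriv (PsiProd l) z / ((ν : ℂ) * PsiProd l z))).re := by
  have hcos : 0 < Real.cos γ := Real.cos_pos_of_mem_Ioo hγ
  have hc : 0 < (1 - α) * Real.cos γ := mul_pos (sub_pos.2 hα.2) hcos
  obtain ⟨r, hr, hrc⟩ := exists_psiSum_eq hmono hpos hsum (mul_pos hc hν)
  have hmonoS := psiSum_strictMonoOn hmono hpos hsum
  refine ⟨r, hr, ?_, fun s hs h => ?_, fun z hz => ?_⟩
  · rw [one_add_mul_deriv_PsiProd_div_ofReal hmono hpos hsum ν hr, hrc,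
      mul_div_cancel_right₀ _ hν.ne']
  · rw [one_add_mul_deriv_PsiProd_div_ofReal hmono hpos hsum ν hs, Complex.ofReal_inj,
      sub_right_inj, div_eq_iff hν.ne', ← hrc] at h
    exact hmonoS.injOn ⟨hs.1.le, hs.2⟩ ⟨hr.1.le, hr.2⟩ h
  · have hzl := hz.trans hr.2
    rw [one_add_mul_deriv_PsiProd_div hmono hpos hsum ν hzl]
    refine lt_of_lt_of_le ?_ (cos_sub_norm_le_re_exp_mul γ _)
    have hlt := (norm_tsum_le_psiSum hmono hpos hsum hzl).trans_lt
      (hmonoS ⟨norm_nonneg z, hzl⟩ ⟨hr.1.le, hr.2⟩ hz)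
    rw [hrc, ← div_lt_iff₀ hν] at hlt
    rw [norm_div, Complex.norm_of_nonneg hν.le]
    linarith
end

section
/- (Theorem 2(a)) Let ν > 0, α ∈ [0,1), γ ∈ (−π/2, π/2). Assume the interlacing inequalities λ'_0 < λ_0 < λ'_1 < λ_1 < λ'_2 < λ_2 < ⋯ and that ν Ψ(z) + z Ψ'(z) = ν Ξ(z) for all z ∈ ℂ. Then there is a unique r_c ∈ (0, λ'_0) such that (1/ν − 1) r_c Ψ'(r_c)/Ψ(r_c) + r_c Ξ'(r_c)/Ξ(r_c) = (α − 1) cos γ, and for every z ∈ ℂ with |z| < r_c one has Re( e^{−iγ} (1 + (1/ν − 1) z Ψ'(z)/Ψ(z) + z Ξ'(z)/Ξ(z)) ) > α cos γ. (The quantity 1 + (1/ν − 1)zΨ'/Ψ + zΞ'/Ξ equals 1 + z f_ν''(z)/f_ν'(z) for the normalization f_ν(z) = z Ψ(z)^{1/ν}, so r_c is the radius of convex γ-spirallikeness of order α of f_ν.) -/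
open Real

lemma differentiableOn_PsiProd_and_hasSum (l : ℕ → ℝ) (hmono : StrictMono l)
    (hpos : ∀ n, 0 < l n) (hsum : Summable fun n => 1 / (l n) ^ 2) :
    DifferentiableOn ℂ (PsiProd l) (Metric.ball 0 (l 0)) ∧
    ∀ z ∈ Metric.ball (0 : ℂ) (l 0), PsiProd l z ≠ 0 ∧
      HasSum (fun n => z ^ 2 / (((l n ^ 2 : ℝ) : ℂ) - z ^ 2))
        (-(z * deriv (PsiProd l) z / PsiProd l z) / 2) := by
  have hfun : PsiProd l = fun z => ∏' n, (1 + -(z ^ 2 / ((l n : ℂ)) ^ 2)) := by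
    funext z; simp [PsiProd, sub_eq_add_neg]
  have hopen : IsOpen (Metric.ball (0 : ℂ) (l 0)) := Metric.isOpen_ball
  have hnorm : ∀ n, ∀ z ∈ Metric.ball (0 : ℂ) (l 0),
      ‖-(z ^ 2 / ((l n : ℂ)) ^ 2)‖ ≤ l 0 ^ 2 * (1 / l n ^ 2) := by
    intro n z hz
    rw [mem_ball_zero_iff] at hz
    rw [norm_neg, norm_div, norm_pow, norm_pow, Complex.norm_real, Real.norm_eq_abs, sq_abs,
      mul_one_div]
    gcongr
  have hprod := Summable.hasProdLocallyUniformlyOn_nat_one_add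
    (f := fun n (z : ℂ) => -(z ^ 2 / ((l n : ℂ)) ^ 2)) hopen
    (hsum.mul_left (l 0 ^ 2)) (Filter.Eventually.of_forall hnorm) (fun n => by fun_prop)
  refine ⟨?_, fun z hz => ?_⟩
  · rw [hfun]
    exact TendstoLocallyUniformlyOn.differentiableOn hprod
      (Filter.Eventually.of_forall fun s => by fun_prop) hopen
  have hlt : ∀ n, ‖z‖ < l n := fun n =>
    (mem_ball_zero_iff.1 hz).trans_le (hmono.monotone (Nat.zero_le n))
  have hsub : ∀ n, ((l n ^ 2 : ℝ) : ℂ) - z ^ 2 ≠ 0 := by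
    intro n h
    have h1 : ‖((l n ^ 2 : ℝ) : ℂ)‖ = ‖z ^ 2‖ := by rw [sub_eq_zero.1 h]
    rw [Complex.norm_real, norm_pow, norm_pow, Real.norm_eq_abs, sq_abs] at h1
    nlinarith [hlt n, norm_nonneg z, pow_lt_pow_left₀ (hlt n) (norm_nonneg z) two_ne_zero]
  have hl : ∀ n, (l n : ℂ) ≠ 0 := fun n => by exact_mod_cast (hpos n).ne'
  have hfac : ∀ n, 1 + -(z ^ 2 / ((l n : ℂ)) ^ 2) ≠ 0 := by
    intro n h
    apply hsub n
    have := hl n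
    field_simp at h
    push_cast
    linear_combination h
  have hne : ∏' n, (1 + -(z ^ 2 / ((l n : ℂ)) ^ 2)) ≠ 0 :=
    tprod_one_add_ne_zero_of_summable hfac
      (.of_nonneg_of_le (fun _ => norm_nonneg _) (fun n => hnorm n z hz)
        (hsum.mul_left (l 0 ^ 2)))
  refine ⟨by rw [hfun]; exact hne, ?_⟩
  have hlog : ∀ n, logDeriv (fun z : ℂ => 1 + -(z ^ 2 / ((l n : ℂ)) ^ 2)) z
      = -2 * z / (((l n ^ 2 : ℝ) : ℂ) - z ^ 2) := by
    intro n
    have hd : HasDerivAt (fun z : ℂ => 1 + -(z ^ 2 / ((l n : ℂ)) ^ 2))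
        (-(2 * z / (l n : ℂ) ^ 2)) z := by
      have := (((hasDerivAt_pow 2 z).div_const ((l n : ℂ) ^ 2)).neg).const_add 1
      simpa using this
    rw [logDeriv_apply, hd.deriv]
    have h1 := hl n
    have h2 := hsub n
    push_cast at h2 ⊢
    have h3 : 1 + -(z ^ 2 / (l n : ℂ) ^ 2) = ((l n : ℂ) ^ 2 - z ^ 2) / (l n : ℂ) ^ 2 := by
      field_simp; ring
    rw [h3]
    field_simp
  have hs : Summable fun n => logDeriv (fun z : ℂ => 1 + -(z ^ 2 / ((l n : ℂ)) ^ 2)) z := by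
    simp only [hlog]
    have h0 : 0 < l 0 ^ 2 - ‖z‖ ^ 2 :=
      sub_pos.2 (pow_lt_pow_left₀ (hlt 0) (norm_nonneg z) two_ne_zero)
    refine Summable.of_norm_bounded
      (hsum.mul_left (2 * ‖z‖ * (l 0 ^ 2 / (l 0 ^ 2 - ‖z‖ ^ 2)))) (fun n => ?_)
    have hle : l 0 ^ 2 ≤ l n ^ 2 :=
      pow_le_pow_left₀ (hpos 0).le (hmono.monotone (Nat.zero_le n)) 2
    have h4 : l n ^ 2 - ‖z‖ ^ 2 ≤ ‖((l n ^ 2 : ℝ) : ℂ) - z ^ 2‖ := by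
      refine le_trans ?_ (norm_sub_norm_le _ _)
      rw [Complex.norm_real, norm_pow, norm_pow, Real.norm_eq_abs, sq_abs]
    have hn := hpos n
    have h5 : 0 < l n ^ 2 - ‖z‖ ^ 2 := by linarith
    have h6 : 1 / (l n ^ 2 - ‖z‖ ^ 2) ≤ (l 0 ^ 2 / (l 0 ^ 2 - ‖z‖ ^ 2)) * (1 / l n ^ 2) := by
      rw [div_mul_div_comm, div_le_div_iff₀ h5 (by positivity)]
      nlinarith [mul_nonneg (sq_nonneg ‖z‖) (sub_nonneg.2 hle)]
    rw [norm_div]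
    calc ‖-2 * z‖ / ‖((l n ^ 2 : ℝ) : ℂ) - z ^ 2‖ ≤ ‖-2 * z‖ / (l n ^ 2 - ‖z‖ ^ 2) := by gcongr
      _ = 2 * ‖z‖ * (1 / (l n ^ 2 - ‖z‖ ^ 2)) := by rw [norm_mul]; simp; ring
      _ ≤ 2 * ‖z‖ * ((l 0 ^ 2 / (l 0 ^ 2 - ‖z‖ ^ 2)) * (1 / l n ^ 2)) := by gcongr
      _ = _ := by ring
  have hmain := logDeriv_tprod_eq_tsum hopen hz hfac (fun n => by fun_prop) hs
    hprod.multipliableLocallyUniformlyOn hne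
  have h7 := hs.hasSum
  rw [← hmain, ← hfun, logDeriv_apply] at h7
  have h8 := h7.mul_left (-z / 2)
  simp only [hlog] at h8
  have hterm : (fun n => -z / 2 * (-2 * z / (((l n ^ 2 : ℝ) : ℂ) - z ^ 2))) =
      fun n => z ^ 2 / (((l n ^ 2 : ℝ) : ℂ) - z ^ 2) := by
    funext n
    ring
  have hval : -z / 2 * (deriv (PsiProd l) z / PsiProd l z) =
      -(z * deriv (PsiProd l) z / PsiProd l z) / 2 := by ring
  rw [hterm, hval] at h8
  exact h8

/-- The `n`-th term of the expansion of `-(1/2)((k-1) zΨ'/Ψ + zΞ'/Ξ)` in the variable `w = z²`. -/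
noncomputable def interlaceTerm {K : Type*} [Field K] (k a b w : K) : K :=
  (k - 1) * (w / (a - w)) + w / (b - w)

lemma interlaceTerm_eq {K : Type*} [Field K] {k a b w : K} (ha : a - w ≠ 0)
    (hb : b - w ≠ 0) : interlaceTerm k a b w =
      k * (w / (b - w)) + (1 - k) * (w * (a - b) / ((b - w) * (a - w))) := by
  unfold interlaceTerm
  field_simp
  ring

lemma sub_norm_le_norm_ofReal_sub {b : ℝ} (w : ℂ) : b - ‖w‖ ≤ ‖(b : ℂ) - w‖ := by
  refine le_trans ?_ (norm_sub_norm_le _ _)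
  rw [Complex.norm_real, Real.norm_eq_abs]
  linarith [le_abs_self b]

lemma norm_interlaceTerm_le {k a b : ℝ} (hk : 0 < k) (hba : b < a) {w : ℂ}
    (hw : ‖w‖ < b) : ‖interlaceTerm (k : ℂ) a b w‖ ≤ interlaceTerm k a b ‖w‖ := by
  have hb := sub_norm_le_norm_ofReal_sub (b := b) w
  have ha := sub_norm_le_norm_ofReal_sub (b := a) w
  have hb0 : 0 < b - ‖w‖ := by linarith
  have ha0 : 0 < a - ‖w‖ := by linarith
  have hbne : (b : ℂ) - w ≠ 0 := norm_pos_iff.1 (by linarith)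
  have hane : (a : ℂ) - w ≠ 0 := norm_pos_iff.1 (by linarith)
  rcases le_total 1 k with h | h
  · unfold interlaceTerm
    refine (norm_add_le _ _).trans ?_
    have : ‖(k : ℂ) - 1‖ = k - 1 := by
      rw [← Complex.ofReal_one, ← Complex.ofReal_sub, Complex.norm_real, Real.norm_eq_abs,
        abs_of_nonneg (by linarith)]
    rw [norm_mul, norm_div, norm_div, this]
    have : 0 ≤ k - 1 := by linarith
    gcongr
  · rw [interlaceTerm_eq hane hbne, interlaceTerm_eq ha0.ne' hb0.ne']
    refine (norm_add_le _ _).trans ?_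
    have h1 : ‖(1 : ℂ) - k‖ = 1 - k := by
      rw [← Complex.ofReal_one, ← Complex.ofReal_sub, Complex.norm_real, Real.norm_eq_abs,
        abs_of_nonneg (by linarith)]
    have h2 : ‖(a : ℂ) - b‖ = a - b := by
      rw [← Complex.ofReal_sub, Complex.norm_real, Real.norm_eq_abs,
        abs_of_nonneg (by linarith)]
    have h3 : ‖(k : ℂ)‖ = k := by
      rw [Complex.norm_real, Real.norm_eq_abs, abs_of_pos hk]
    rw [norm_mul, norm_div, norm_mul, norm_div, norm_mul, norm_mul, h1, h2, h3]
    have : 0 ≤ 1 - k := by linarith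
    have : 0 ≤ a - b := by linarith
    gcongr

lemma interlaceTerm_lt_interlaceTerm {k a b x y : ℝ} (hk : 0 < k) (hba : b < a)
    (hx : 0 ≤ x) (hxy : x < y) (hy : y < b) : interlaceTerm k a b x < interlaceTerm k a b y := by
  have hbx : 0 < b - x := by linarith
  have hby : 0 < b - y := by linarith
  have hax : 0 < a - x := by linarith
  have hay : 0 < a - y := by linarith
  have h0y : 0 ≤ y := by linarith
  have h1 : x / (b - x) < y / (b - y) := by
    rw [div_lt_div_iff₀ hbx hby]; nlinarith
  rcases le_total 1 k with h | h
  · have : 0 ≤ k - 1 := by linarith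
    unfold interlaceTerm
    refine add_lt_add_of_le_of_lt ?_ h1
    gcongr
  · rw [interlaceTerm_eq hax.ne' hbx.ne', interlaceTerm_eq hay.ne' hby.ne']
    refine add_lt_add_of_lt_of_le (mul_lt_mul_of_pos_left h1 hk) ?_
    have : 0 ≤ 1 - k := by linarith
    have : 0 ≤ a - b := by linarith
    gcongr

lemma min_mul_le_interlaceTerm {k a b x : ℝ} (hba : b < a)
    (hx : 0 ≤ x) (hxb : x < b) : min 1 k * (x / (b - x)) ≤ interlaceTerm k a b x := by
  have hbx : 0 < b - x := by linarith
  have hax : 0 < a - x := by linarith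
  rcases le_total 1 k with h | h
  · have : 0 ≤ k - 1 := by linarith
    rw [min_eq_left h, interlaceTerm, one_mul]
    exact le_add_of_nonneg_left (by positivity)
  · have : 0 ≤ 1 - k := by linarith
    have : 0 ≤ a - b := by linarith
    rw [min_eq_right h, interlaceTerm_eq hax.ne' hbx.ne']
    exact le_add_of_nonneg_right (by positivity)

theorem stmt_12 (l l' : ℕ → ℝ) (hmono : StrictMono l) (hmono' : StrictMono l')
    (hpos : ∀ n, 0 < l n) (hpos' : ∀ n, 0 < l' n)
    (hsum : Summable fun n => 1 / (l n) ^ 2) (hsum' : Summable fun n => 1 / (l' n) ^ 2)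
    (hinter : ∀ n, l' n < l n ∧ l n < l' (n + 1))
    (ν α γ : ℝ) (hν : 0 < ν) (hα : α ∈ Set.Ico (0 : ℝ) 1)
    (hγ : γ ∈ Set.Ioo (-(π / 2)) (π / 2))
    (hrel : ∀ z : ℂ, (ν : ℂ) * PsiProd l z + z * deriv (PsiProd l) z = (ν : ℂ) * PsiProd l' z) :
    ∃ r : ℝ, r ∈ Set.Ioo 0 (l' 0) ∧
      (((1 / ν - 1 : ℝ) : ℂ) * (r : ℂ) * deriv (PsiProd l) r / PsiProd l r +
          (r : ℂ) * deriv (PsiProd l') r / PsiProd l' r = (((α - 1) * Real.cos γ : ℝ) : ℂ)) ∧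
      (∀ s ∈ Set.Ioo (0 : ℝ) (l' 0),
        (((1 / ν - 1 : ℝ) : ℂ) * (s : ℂ) * deriv (PsiProd l) s / PsiProd l s +
            (s : ℂ) * deriv (PsiProd l') s / PsiProd l' s = (((α - 1) * Real.cos γ : ℝ) : ℂ)) →
          s = r) ∧
      ∀ z : ℂ, ‖z‖ < r →
        α * Real.cos γ <
          (Complex.exp (-Complex.I * (γ : ℂ)) *
            (1 + ((1 / ν - 1 : ℝ) : ℂ) * z * deriv (PsiProd l) z / PsiProd l z +
              z * deriv (PsiProd l') z / PsiProd l' z)).re := by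
  obtain ⟨hdΨ, hΨ⟩ := differentiableOn_PsiProd_and_hasSum l hmono hpos hsum
  obtain ⟨hdΞ, hΞ⟩ := differentiableOn_PsiProd_and_hasSum l' hmono' hpos' hsum'
  have hk : 0 < 1 / ν := by positivity
  set k : ℝ := 1 / ν
  have hcos : 0 < Real.cos γ := Real.cos_pos_of_mem_Ioo hγ
  have hc : 0 < (1 - α) * Real.cos γ / 2 := by
    have : 0 < 1 - α := by linarith [hα.2]
    positivity
  have hsub : Metric.ball (0 : ℂ) (l' 0) ⊆ Metric.ball 0 (l 0) :=
    Metric.ball_subset_ball (hinter 0).1.le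
  have hsq : ∀ n, l' n ^ 2 < l n ^ 2 := fun n =>
    pow_lt_pow_left₀ (hinter n).1 (hpos' n).le two_ne_zero
  have hbd : ∀ n, ∀ s : ℝ, 0 ≤ s → s < l' 0 → s ^ 2 < l' n ^ 2 := fun n s h0 h1 =>
    pow_lt_pow_left₀ (h1.trans_le (hmono'.monotone (Nat.zero_le n))) h0 two_ne_zero
  let F : ℂ → ℂ := fun z => ((k - 1 : ℝ) : ℂ) * z * deriv (PsiProd l) z / PsiProd l z +
    z * deriv (PsiProd l') z / PsiProd l' z
  have hF : ∀ z ∈ Metric.ball (0 : ℂ) (l' 0), HasSum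
      (fun n => interlaceTerm (k : ℂ) ((l n ^ 2 : ℝ) : ℂ) ((l' n ^ 2 : ℝ) : ℂ) (z ^ 2))
      (-F z / 2) := by
    intro z hz
    have hval : -F z / 2 = ((k : ℂ) - 1) * (-(z * deriv (PsiProd l) z / PsiProd l z) / 2) +
        -(z * deriv (PsiProd l') z / PsiProd l' z) / 2 := by
      simp only [F]
      push_cast
      ring
    rw [hval]
    exact ((hΨ z (hsub hz)).2.mul_left ((k : ℂ) - 1)).add (hΞ z hz).2
  let G : ℝ → ℝ := fun s =>
    ∑' n, interlaceTerm k (l n ^ 2) (l' n ^ 2) (s ^ 2)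
  have hmem : ∀ s : ℝ, 0 ≤ s → s < l' 0 → (s : ℂ) ∈ Metric.ball (0 : ℂ) (l' 0) := by
    intro s h0 h1
    rwa [mem_ball_zero_iff, Complex.norm_real, Real.norm_eq_abs, abs_of_nonneg h0]
  have hcast : ∀ s : ℝ, (fun n => interlaceTerm (k : ℂ) ((l n ^ 2 : ℝ) : ℂ) ((l' n ^ 2 : ℝ) : ℂ)
      ((s : ℂ) ^ 2)) = fun n => ((interlaceTerm k (l n ^ 2) (l' n ^ 2) (s ^ 2) : ℝ) : ℂ) := by
    intro s
    funext n
    simp only [interlaceTerm]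
    push_cast
    ring
  have hG : ∀ s : ℝ, 0 ≤ s → s < l' 0 →
      HasSum (fun n => interlaceTerm k (l n ^ 2) (l' n ^ 2) (s ^ 2)) (G s) ∧
      F s = ((-2 * G s : ℝ) : ℂ) := by
    intro s h0 h1
    have h := hF s (hmem s h0 h1)
    rw [hcast] at h
    have h2 : Summable fun n => interlaceTerm k (l n ^ 2) (l' n ^ 2) (s ^ 2) :=
      Complex.summable_ofReal.1 h.summable
    refine ⟨h2.hasSum, ?_⟩
    have h3 := h.unique (Complex.hasSum_ofReal.2 h2.hasSum)
    push_cast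
    linear_combination (-2 : ℂ) * h3
  have hGmono : ∀ s t : ℝ, 0 ≤ s → s < t → t < l' 0 → G s < G t := by
    intro s t h0 hst ht
    have hst2 : s ^ 2 < t ^ 2 := pow_lt_pow_left₀ hst h0 two_ne_zero
    have hlt : ∀ n, interlaceTerm k (l n ^ 2) (l' n ^ 2) (s ^ 2) <
        interlaceTerm k (l n ^ 2) (l' n ^ 2) (t ^ 2) := fun n =>
      interlaceTerm_lt_interlaceTerm hk (hsq n) (sq_nonneg s) hst2 (hbd n t (h0.trans hst.le) ht)
    exact hasSum_lt (fun n => (hlt n).le) (hlt 0) (hG s h0 (hst.trans ht)).1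
      (hG t (h0.trans hst.le) ht).1
  have hGcont : ContinuousOn G (Set.Ico 0 (l' 0)) := by
    have hFc : ContinuousOn F (Metric.ball (0 : ℂ) (l' 0)) := by
      have h1 := (hdΨ.deriv Metric.isOpen_ball).continuousOn.mono hsub
      have h2 := hdΨ.continuousOn.mono hsub
      have h3 := (hdΞ.deriv Metric.isOpen_ball).continuousOn
      have h4 := hdΞ.continuousOn
      exact (((continuousOn_const.mul continuousOn_id).mul h1).div h2
        (fun z hz => (hΨ z (hsub hz)).1)).add
        ((continuousOn_id.mul h3).div h4 (fun z hz => (hΞ z hz).1))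
    have hcomp : ContinuousOn (fun s : ℝ => -(F s).re / 2) (Set.Ico 0 (l' 0)) := by
      have := hFc.comp Complex.continuous_ofReal.continuousOn
        (fun s (hs : s ∈ Set.Ico 0 (l' 0)) => hmem s hs.1 hs.2)
      exact (Complex.continuous_re.comp_continuousOn this).neg.div_const 2
    refine hcomp.congr fun s hs => ?_
    change G s = -(F s).re / 2
    rw [(hG s hs.1 hs.2).2, Complex.ofReal_re]
    ring
  have hG0 : G 0 = 0 := by simp [G, interlaceTerm]
  have hiff : ∀ s ∈ Set.Ioo (0 : ℝ) (l' 0), F s = (((α - 1) * Real.cos γ : ℝ) : ℂ) ↔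
      G s = (1 - α) * Real.cos γ / 2 := by
    intro s hs
    rw [(hG s hs.1.le hs.2).2, Complex.ofReal_inj]
    constructor <;> intro h <;> linarith
  generalize hcdef : (1 - α) * Real.cos γ / 2 = c at hc hiff
  obtain ⟨x, hx0, hxl, hxc⟩ : ∃ x, 0 ≤ x ∧ x < l' 0 ∧ c ≤ G x := by
    have hm : 0 < min 1 k := lt_min one_pos hk
    have hb : 0 < l' 0 ^ 2 := pow_pos (hpos' 0) 2
    set m := min 1 k
    set y := l' 0 ^ 2 * c / (m + c) with hy
    have hy0 : 0 ≤ y := by positivity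
    have hyb : y < l' 0 ^ 2 := by
      rw [hy, div_lt_iff₀ (by positivity)]
      nlinarith
    refine ⟨√y, Real.sqrt_nonneg y, (Real.sqrt_lt' (hpos' 0)).2 hyb, ?_⟩
    have hxl := (Real.sqrt_lt' (hpos' 0)).2 hyb
    have hn : ∀ n, m * (√y ^ 2 / (l' n ^ 2 - √y ^ 2)) ≤
        interlaceTerm k (l n ^ 2) (l' n ^ 2) (√y ^ 2) := fun n =>
      min_mul_le_interlaceTerm (hsq n) (sq_nonneg _) (hbd n _ (Real.sqrt_nonneg y) hxl)
    have hnn : ∀ n, 0 ≤ interlaceTerm k (l n ^ 2) (l' n ^ 2) (√y ^ 2) := fun n =>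
      le_trans (mul_nonneg hm.le (div_nonneg (sq_nonneg _)
        (sub_nonneg.2 (hbd n _ (Real.sqrt_nonneg y) hxl).le))) (hn n)
    refine le_trans ?_ ((hn 0).trans
      (le_hasSum (hG _ (Real.sqrt_nonneg y) hxl).1 0 fun n _ => hnn n))
    rw [Real.sq_sqrt hy0]
    have h1 : l' 0 ^ 2 - y = l' 0 ^ 2 * m / (m + c) := by rw [hy]; field_simp; ring
    rw [h1, hy]
    refine le_of_eq ?_
    have := (hpos' 0).ne'
    field_simp
  obtain ⟨r, hr, hrc⟩ : ∃ r ∈ Set.Icc 0 x, G r = c :=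
    intermediate_value_Icc hx0 (hGcont.mono fun t ht => ⟨ht.1, ht.2.trans_lt hxl⟩)
      ⟨by rw [hG0]; exact hc.le, hxc⟩
  have hrpos : 0 < r := by
    rcases hr.1.eq_or_lt with h | h
    · rw [← h, hG0] at hrc
      exact absurd hrc hc.ne
    · exact h
  have hrl : r < l' 0 := hr.2.trans_lt hxl
  refine ⟨r, ⟨hrpos, hrl⟩, (hiff r ⟨hrpos, hrl⟩).2 hrc, fun s hs hs' => ?_, fun z hz => ?_⟩
  · have hsc := (hiff s hs).1 hs'
    rcases lt_trichotomy s r with h | h | h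
    · exact absurd (hGmono s r hs.1.le h hrl) (by rw [hsc, hrc]; exact lt_irrefl c)
    · exact h
    · exact absurd (hGmono r s hrpos.le h hs.2) (by rw [hsc, hrc]; exact lt_irrefl c)
  · have hzl : ‖z‖ < l' 0 := hz.trans hrl
    have hle : ‖-F z / 2‖ ≤ G ‖z‖ := by
      have h := hF z (mem_ball_zero_iff.2 hzl)
      rw [← h.tsum_eq]
      refine tsum_of_norm_bounded (hG ‖z‖ (norm_nonneg z) hzl).1 fun n => ?_
      have := norm_interlaceTerm_le hk (hsq n) (w := z ^ 2)
        (by rw [norm_pow]; exact hbd n _ (norm_nonneg z) hzl)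
      rwa [norm_pow] at this
    have hlt : ‖F z‖ / 2 < c := by
      rw [norm_div, norm_neg, Complex.norm_ofNat] at hle
      exact hle.trans_lt (hrc ▸ hGmono _ _ (norm_nonneg z) hz hrl)
    have hexp : Complex.exp (-Complex.I * (γ : ℂ)) = Complex.exp (((-γ : ℝ) : ℂ) * Complex.I) := by
      congr 1
      push_cast
      ring
    have hre : (Complex.exp (-Complex.I * (γ : ℂ))).re = Real.cos γ := by
      rw [hexp, Complex.exp_ofReal_mul_I_re, Real.cos_neg]
    have hnm : ‖Complex.exp (-Complex.I * (γ : ℂ))‖ = 1 := by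
      rw [hexp, Complex.norm_exp_ofReal_mul_I]
    have habs : |(Complex.exp (-Complex.I * (γ : ℂ)) * F z).re| ≤ ‖F z‖ := by
      refine (Complex.abs_re_le_norm _).trans ?_
      rw [norm_mul, hnm, one_mul]
    rw [add_assoc, mul_add, mul_one, Complex.add_re, hre]
    have := (abs_le.1 habs).1
    change α * Real.cos γ < Real.cos γ + (Complex.exp (-Complex.I * (γ : ℂ)) * F z).re
    linarith
end

section
/- (Theorem 2(b)) Let α ∈ [0,1) and γ ∈ (−π/2, π/2). Let g(z) = z Ψ(z) and assume there is a strictly increasing sequence (δ_n)_{n≥0} of positive real numbers with Σ_{n≥0} 1/δ_n² < ∞ such that g'(z) = ∏_{n≥0} (1 − z²/δ_n²) for all z ∈ ℂ. Then there is a unique r_c ∈ (0, δ_0) such that r_c g''(r_c)/g'(r_c) = (α − 1) cos γ, and for every z ∈ ℂ with |z| < r_c one has Re( e^{−iγ} (1 + z g''(z)/g'(z)) ) > α cos γ; that is, r_c is the radius of convex γ-spirallikeness of order α of g. -/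
lemma sq_lt_sq_of_lt_first {δ : ℕ → ℝ} (hδmono : StrictMono δ) {s : ℝ} (hs0 : 0 ≤ s)
    (hs : s < δ 0) (n : ℕ) : s ^ 2 < δ n ^ 2 :=
  pow_lt_pow_left₀ (hs.trans_le (hδmono.monotone n.zero_le)) hs0 two_ne_zero

lemma summable_two_mul_sq_div {δ : ℕ → ℝ} (hδmono : StrictMono δ)
    (hδsum : Summable fun n => 1 / (δ n) ^ 2) {s : ℝ} (hs0 : 0 ≤ s) (hs : s < δ 0) :
    Summable fun n => 2 * s ^ 2 / (δ n ^ 2 - s ^ 2) := by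
  have h0 := sq_lt_sq_of_lt_first hδmono hs0 hs 0
  have hlt := sq_lt_sq_of_lt_first hδmono hs0 hs
  refine .of_nonneg_of_le (fun n => div_nonneg (by positivity) (sub_pos.2 (hlt n)).le)
    (fun n => ?_) (hδsum.mul_left (2 * s ^ 2 * δ 0 ^ 2 / (δ 0 ^ 2 - s ^ 2)))
  have hle : δ 0 ^ 2 ≤ δ n ^ 2 :=
    pow_le_pow_left₀ (hs0.trans hs.le) (hδmono.monotone n.zero_le) 2
  have hn : 0 < δ n ^ 2 := (sq_nonneg s).trans_lt (hlt n)
  rw [div_mul_div_comm, mul_one, div_le_div_iff₀ (sub_pos.2 (hlt n))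
    (mul_pos (sub_pos.2 h0) hn)]
  have key : (δ 0 ^ 2 - s ^ 2) * δ n ^ 2 ≤ δ 0 ^ 2 * (δ n ^ 2 - s ^ 2) := by
    nlinarith [mul_nonneg (sq_nonneg s) (sub_nonneg.2 hle)]
  calc 2 * s ^ 2 * ((δ 0 ^ 2 - s ^ 2) * δ n ^ 2)
      ≤ 2 * s ^ 2 * (δ 0 ^ 2 * (δ n ^ 2 - s ^ 2)) := by gcongr
    _ = 2 * s ^ 2 * δ 0 ^ 2 * (δ n ^ 2 - s ^ 2) := by ring

lemma two_mul_sq_div_lt {s t d : ℝ} (hs0 : 0 ≤ s) (hst : s < t) (ht : t ^ 2 < d ^ 2) :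
    2 * s ^ 2 / (d ^ 2 - s ^ 2) < 2 * t ^ 2 / (d ^ 2 - t ^ 2) := by
  have h : s ^ 2 < t ^ 2 := pow_lt_pow_left₀ hst hs0 two_ne_zero
  rw [div_lt_div_iff₀ (by linarith) (by linarith)]
  nlinarith [mul_pos (sub_pos.2 h) ((sq_nonneg t).trans_lt ht)]

lemma strictMonoOn_tsum_two_mul_sq_div {δ : ℕ → ℝ} (hδmono : StrictMono δ)
    (hδsum : Summable fun n => 1 / (δ n) ^ 2) :
    StrictMonoOn (fun s : ℝ => ∑' n, 2 * s ^ 2 / (δ n ^ 2 - s ^ 2)) (Set.Ico 0 (δ 0)) := by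
  intro s hs t ht hst
  have h n := two_mul_sq_div_lt hs.1 hst (sq_lt_sq_of_lt_first hδmono ht.1 ht.2 n)
  exact Summable.tsum_lt_tsum (i := 0) (fun n => (h n).le) (h 0)
    (summable_two_mul_sq_div hδmono hδsum hs.1 hs.2)
    (summable_two_mul_sq_div hδmono hδsum ht.1 ht.2)

lemma continuousOn_tsum_two_mul_sq_div {δ : ℕ → ℝ} (hδmono : StrictMono δ)
    (hδsum : Summable fun n => 1 / (δ n) ^ 2) {b : ℝ} (hb0 : 0 ≤ b) (hb : b < δ 0) :
    ContinuousOn (fun s : ℝ => ∑' n, 2 * s ^ 2 / (δ n ^ 2 - s ^ 2)) (Set.Icc 0 b) := by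
  have hlt (n : ℕ) {s : ℝ} (hs : s ∈ Set.Icc 0 b) :=
    sq_lt_sq_of_lt_first hδmono hs.1 (hs.2.trans_lt hb) n
  refine continuousOn_tsum (fun n => ?_) (summable_two_mul_sq_div hδmono hδsum hb0 hb)
    fun n s hs => ?_
  · exact ContinuousOn.div (by fun_prop) (by fun_prop) fun s hs => (sub_pos.2 (hlt n hs)).ne'
  · rw [Real.norm_of_nonneg (div_nonneg (by positivity) (sub_pos.2 (hlt n hs)).le)]
    obtain h | rfl := hs.2.lt_or_eq
    · exact (two_mul_sq_div_lt hs.1 h (hlt n ⟨hb0, le_rfl⟩)).le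
    · exact le_rfl

lemma exists_tsum_two_mul_sq_div_eq {δ : ℕ → ℝ} (hδmono : StrictMono δ) (hδpos : 0 < δ 0)
    (hδsum : Summable fun n => 1 / (δ n) ^ 2) {c : ℝ} (hc : 0 < c) :
    ∃ r ∈ Set.Ioo 0 (δ 0), ∑' n, 2 * r ^ 2 / (δ n ^ 2 - r ^ 2) = c := by
  set b := δ 0 * √(c / (2 + c)) with hb
  have hb0 : 0 ≤ b := by positivity
  have hbsq : b ^ 2 = δ 0 ^ 2 * (c / (2 + c)) := by
    rw [hb, mul_pow, Real.sq_sqrt (by positivity)]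
  have hblt : b < δ 0 := by
    refine lt_of_pow_lt_pow_left₀ 2 hδpos.le ?_
    rw [hbsq]
    exact mul_lt_of_lt_one_right (by positivity) ((div_lt_one (by positivity)).2 (by linarith))
  have hfirst : 2 * b ^ 2 / (δ 0 ^ 2 - b ^ 2) = c := by
    rw [div_eq_iff (sub_pos.2 (sq_lt_sq_of_lt_first hδmono hb0 hblt 0)).ne', hbsq]
    field_simp
    ring
  have hcb : c ≤ ∑' n, 2 * b ^ 2 / (δ n ^ 2 - b ^ 2) := by
    conv_lhs => rw [← hfirst]
    exact (summable_two_mul_sq_div hδmono hδsum hb0 hblt).le_tsum 0 fun n _ =>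
      div_nonneg (by positivity) (sub_pos.2 (sq_lt_sq_of_lt_first hδmono hb0 hblt n)).le
  obtain ⟨r, hr, hrc⟩ := intermediate_value_Icc hb0
    (continuousOn_tsum_two_mul_sq_div hδmono hδsum hb0 hblt) (show c ∈ _ by simp [hc.le, hcb])
  refine ⟨r, ⟨hr.1.lt_of_ne ?_, hr.2.trans_lt hblt⟩, hrc⟩
  rintro rfl
  simp [hc.ne] at hrc

lemma norm_sq_sub_norm_sq_le (z : ℂ) (d : ℝ) : d ^ 2 - ‖z‖ ^ 2 ≤ ‖(d : ℂ) ^ 2 - z ^ 2‖ := by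
  calc d ^ 2 - ‖z‖ ^ 2 = ‖(d : ℂ) ^ 2‖ - ‖z ^ 2‖ := by simp
    _ ≤ ‖(d : ℂ) ^ 2 - z ^ 2‖ := norm_sub_norm_le _ _

lemma norm_two_mul_sq_div_le {z : ℂ} {d : ℝ} (h : ‖z‖ ^ 2 < d ^ 2) :
    ‖2 * z ^ 2 / ((d : ℂ) ^ 2 - z ^ 2)‖ ≤ 2 * ‖z‖ ^ 2 / (d ^ 2 - ‖z‖ ^ 2) := by
  rw [norm_div, norm_mul, norm_pow, Complex.norm_two]
  exact div_le_div_of_nonneg_left (by positivity) (sub_pos.2 h) (norm_sq_sub_norm_sq_le z d)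

/-- The logarithmic derivative of `∏ (1 - z² / δ_n²)` inside the disc of radius `δ_0`. -/
lemma mul_logDeriv_tprod_one_sub_sq_div {δ : ℕ → ℝ} (hδmono : StrictMono δ)
    (hδpos : ∀ n, 0 < δ n) (hδsum : Summable fun n => 1 / (δ n) ^ 2) {z : ℂ} (hz : ‖z‖ < δ 0) :
    z * logDeriv (fun w : ℂ => ∏' n, (1 - w ^ 2 / (δ n : ℂ) ^ 2)) z =
      -∑' n, 2 * z ^ 2 / ((δ n : ℂ) ^ 2 - z ^ 2) := by
  have hlt := sq_lt_sq_of_lt_first hδmono (norm_nonneg z) hz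
  have hd (n : ℕ) : (δ n : ℂ) ≠ 0 := by exact_mod_cast (hδpos n).ne'
  have hsub (n : ℕ) : (δ n : ℂ) ^ 2 - z ^ 2 ≠ 0 :=
    norm_pos_iff.1 ((sub_pos.2 (hlt n)).trans_le (norm_sq_sub_norm_sq_le z _))
  have hfac (n : ℕ) : 1 - z ^ 2 / (δ n : ℂ) ^ 2 ≠ 0 := by
    rw [one_sub_div (pow_ne_zero 2 (hd n))]
    exact div_ne_zero (hsub n) (pow_ne_zero 2 (hd n))
  have hnorm (n : ℕ) (w : ℂ) : ‖-(w ^ 2 / (δ n : ℂ) ^ 2)‖ = ‖w‖ ^ 2 * (1 / δ n ^ 2) := by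
    simp [div_eq_mul_inv]
  have hterm (n : ℕ) : z * logDeriv (fun w : ℂ => 1 - w ^ 2 / (δ n : ℂ) ^ 2) z =
      -(2 * z ^ 2 / ((δ n : ℂ) ^ 2 - z ^ 2)) := by
    have hderiv : deriv (fun w : ℂ => 1 - w ^ 2 / (δ n : ℂ) ^ 2) z = -(2 * z / (δ n : ℂ) ^ 2) := by
      simp
    rw [logDeriv_apply, hderiv, one_sub_div (pow_ne_zero 2 (hd n))]
    have := hd n
    have := hsub n
    field_simp
  have hprod : ∏' n, (1 - z ^ 2 / (δ n : ℂ) ^ 2) ≠ 0 := by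
    simp only [sub_eq_add_neg] at hfac ⊢
    refine tprod_one_add_ne_zero_of_summable hfac ?_
    simpa only [hnorm] using hδsum.mul_left _
  have hunif : MultipliableLocallyUniformlyOn (fun (n : ℕ) (w : ℂ) => 1 - w ^ 2 / (δ n : ℂ) ^ 2)
      (Metric.ball 0 (δ 0)) := by
    simp only [sub_eq_add_neg]
    refine Summable.multipliableLocallyUniformlyOn_nat_one_add Metric.isOpen_ball
      (hδsum.mul_left (δ 0 ^ 2)) (.of_forall fun n w hw => ?_) fun n => by fun_prop
    rw [hnorm]
    have : ‖w‖ ≤ δ 0 := (mem_ball_zero_iff.1 hw).le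
    gcongr
  rcases eq_or_ne z 0 with rfl | hz0
  · simp
  have hsumm : Summable fun n => logDeriv (fun w : ℂ => 1 - w ^ 2 / (δ n : ℂ) ^ 2) z := by
    rw [← summable_mul_left_iff hz0]
    simp only [hterm]
    exact (Summable.of_norm_bounded
      (summable_two_mul_sq_div hδmono hδsum (norm_nonneg z) hz)
      fun n => norm_two_mul_sq_div_le (hlt n)).neg
  rw [logDeriv_tprod_eq_tsum Metric.isOpen_ball (mem_ball_zero_iff.2 hz) hfac
    (fun n => by fun_prop) hsumm hunif hprod, ← tsum_mul_left, ← tsum_neg]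
  exact tsum_congr hterm

/-- Adding a perturbation `w` with `‖w‖ < (1 - α) cos γ` keeps `Re (e^{-iγ} (1 + w))` above
`α cos γ`. -/
lemma lt_re_exp_mul_one_add {α γ : ℝ} {w : ℂ} (hw : ‖w‖ < (1 - α) * Real.cos γ) :
    α * Real.cos γ < (Complex.exp (-Complex.I * (γ : ℂ)) * (1 + w)).re := by
  have he : Complex.exp (-Complex.I * (γ : ℂ)) = Complex.exp ((-γ : ℝ) * Complex.I) := by
    push_cast
    ring_nf
  have hre : (Complex.exp ((-γ : ℝ) * Complex.I)).re = Real.cos γ := by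
    rw [Complex.exp_ofReal_mul_I_re, Real.cos_neg]
  have hle := Complex.abs_re_le_norm (Complex.exp ((-γ : ℝ) * Complex.I) * w)
  rw [norm_mul, Complex.norm_exp_ofReal_mul_I, one_mul] at hle
  rw [he, mul_add, mul_one, Complex.add_re, hre]
  linarith [neg_abs_le (Complex.exp ((-γ : ℝ) * Complex.I) * w).re]


open Real

theorem stmt_13 (l : ℕ → ℝ) (hmono : StrictMono l) (hpos : ∀ n, 0 < l n)
    (hsum : Summable fun n => 1 / (l n) ^ 2) (α γ : ℝ)
    (hα : α ∈ Set.Ico (0 : ℝ) 1) (hγ : γ ∈ Set.Ioo (-(π / 2)) (π / 2))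
    (g : ℂ → ℂ) (hg : ∀ z : ℂ, g z = z * PsiProd l z)
    (δ : ℕ → ℝ) (hδmono : StrictMono δ) (hδpos : ∀ n, 0 < δ n)
    (hδsum : Summable fun n => 1 / (δ n) ^ 2)
    (hg' : ∀ z : ℂ, deriv g z = ∏' n : ℕ, (1 - z ^ 2 / ((δ n : ℂ)) ^ 2)) :
    ∃ r : ℝ, r ∈ Set.Ioo 0 (δ 0) ∧
      ((r : ℂ) * deriv (deriv g) r / deriv g r = (((α - 1) * Real.cos γ : ℝ) : ℂ)) ∧
      (∀ s ∈ Set.Ioo (0 : ℝ) (δ 0),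
        ((s : ℂ) * deriv (deriv g) s / deriv g s = (((α - 1) * Real.cos γ : ℝ) : ℂ)) → s = r) ∧
      ∀ z : ℂ, ‖z‖ < r →
        α * Real.cos γ <
          (Complex.exp (-Complex.I * (γ : ℂ)) *
            (1 + z * deriv (deriv g) z / deriv g z)).re := by
  have hc : 0 < (1 - α) * Real.cos γ :=
    mul_pos (sub_pos.2 hα.2) (Real.cos_pos_of_mem_Ioo hγ)
  have hlog {z : ℂ} (hz : ‖z‖ < δ 0) : z * deriv (deriv g) z / deriv g z =
      -∑' n, 2 * z ^ 2 / ((δ n : ℂ) ^ 2 - z ^ 2) := by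
    rw [← mul_logDeriv_tprod_one_sub_sq_div hδmono hδpos hδsum hz, ← funext hg', logDeriv_apply,
      mul_div_assoc]
  have hreal {s : ℝ} (hs : s ∈ Set.Ioo 0 (δ 0)) :
      (s : ℂ) * deriv (deriv g) s / deriv g s = (((α - 1) * Real.cos γ : ℝ) : ℂ) ↔
        ∑' n, 2 * s ^ 2 / (δ n ^ 2 - s ^ 2) = (1 - α) * Real.cos γ := by
    have hcast : -∑' n, 2 * (s : ℂ) ^ 2 / ((δ n : ℂ) ^ 2 - (s : ℂ) ^ 2) =
        ((-∑' n, 2 * s ^ 2 / (δ n ^ 2 - s ^ 2) : ℝ) : ℂ) := by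
      push_cast
      rfl
    rw [hlog (by simpa [abs_of_pos hs.1] using hs.2), hcast, Complex.ofReal_inj, neg_eq_iff_eq_neg,
      ← neg_mul, neg_sub]
  have hmonoOn := strictMonoOn_tsum_two_mul_sq_div hδmono hδsum
  obtain ⟨r, hr, hrc⟩ := exists_tsum_two_mul_sq_div_eq hδmono (hδpos 0) hδsum hc
  refine ⟨r, hr, (hreal hr).2 hrc, fun s hs hsc => ?_, fun z hz => ?_⟩
  · exact hmonoOn.injOn ⟨hs.1.le, hs.2⟩ ⟨hr.1.le, hr.2⟩ (((hreal hs).1 hsc).trans hrc.symm)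
  · have hz0 : ‖z‖ < δ 0 := hz.trans hr.2
    refine lt_re_exp_mul_one_add ?_
    rw [hlog hz0, norm_neg, ← hrc]
    exact (tsum_of_norm_bounded
      (summable_two_mul_sq_div hδmono hδsum (norm_nonneg z) hz0).hasSum fun n =>
        norm_two_mul_sq_div_le (sq_lt_sq_of_lt_first hδmono (norm_nonneg z) hz0 n)).trans_lt
      (hmonoOn ⟨norm_nonneg z, hz0⟩ ⟨hr.1.le, hr.2⟩ hz)
end

section
/- (Theorem 3, case f_ν) Let ν > 0 and β > 0. Then there is a unique R ∈ (0, λ_0) such that (1/ν) Σ_{n≥0} 2R²/(λ_n² − R²) = β, and: (i) for every z ∈ ℂ with |z| < R one has |z Ψ'(z)/(ν Ψ(z))| < β; (ii) at z = R one has |R Ψ'(R)/(ν Ψ(R))| = β. (Since z f_ν'(z)/f_ν(z) − 1 = zΨ'(z)/(νΨ(z)) for f_ν(z) = z Ψ(z)^{1/ν}, this says R is the largest radius on which the values of z f_ν'(z)/f_ν(z) lie in the disk {w : |w − 1| < β}, and hence the 𝒮*(φ)-radius of f_ν for any Ma–Minda function φ whose image contains this disk with φ(−1) = 1 − β.) 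-/
open Real

lemma sq_lt_sq_of_lt_zeroth {l : ℕ → ℝ} (hmono : StrictMono l) {s : ℝ} (hs : 0 ≤ s)
    (hsl : s < l 0) (n : ℕ) : s ^ 2 < l n ^ 2 := by
  have := hmono.monotone (Nat.zero_le n)
  exact pow_lt_pow_left₀ (by linarith) hs two_ne_zero

lemma term_le_const_div_sq {l : ℕ → ℝ} (hmono : StrictMono l) (hpos : ∀ n, 0 < l n)
    {s b : ℝ} (hs : 0 ≤ s) (hsb : s ≤ b) (hb : b < l 0) (n : ℕ) :
    2 * s ^ 2 / (l n ^ 2 - s ^ 2) ≤ 2 * b ^ 2 * l 0 ^ 2 / (l 0 ^ 2 - b ^ 2) * (1 / l n ^ 2) := by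
  have h0 := sq_lt_sq_of_lt_zeroth hmono (hs.trans hsb) hb 0
  have hn := sq_lt_sq_of_lt_zeroth hmono hs (hsb.trans_lt hb) n
  have hsb2 : s ^ 2 ≤ b ^ 2 := pow_le_pow_left₀ hs hsb 2
  have h0n : l 0 ^ 2 ≤ l n ^ 2 :=
    pow_le_pow_left₀ (hpos 0).le (hmono.monotone (Nat.zero_le n)) 2
  have hln : 0 < l n ^ 2 := pow_pos (hpos n) 2
  have hl0 : 0 < l 0 ^ 2 := pow_pos (hpos 0) 2
  rw [div_mul_div_comm, mul_one, div_le_div_iff₀ (by linarith) (mul_pos (by linarith) hln)]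
  have h1 : (l 0 ^ 2 - b ^ 2) * l n ^ 2 ≤ l 0 ^ 2 * (l n ^ 2 - s ^ 2) := by
    nlinarith [sq_nonneg s, sq_nonneg b]
  calc 2 * s ^ 2 * ((l 0 ^ 2 - b ^ 2) * l n ^ 2)
      ≤ 2 * b ^ 2 * (l 0 ^ 2 * (l n ^ 2 - s ^ 2)) :=
        mul_le_mul (by linarith) h1 (mul_nonneg (by linarith) hln.le) (by positivity)
    _ = _ := by ring

lemma term_nonneg {l : ℕ → ℝ} (hmono : StrictMono l) {s : ℝ} (hs : 0 ≤ s) (hsl : s < l 0)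
    (n : ℕ) : 0 ≤ 2 * s ^ 2 / (l n ^ 2 - s ^ 2) :=
  div_nonneg (by positivity) (sub_nonneg.2 (sq_lt_sq_of_lt_zeroth hmono hs hsl n).le)

lemma summable_term {l : ℕ → ℝ} (hmono : StrictMono l) (hpos : ∀ n, 0 < l n)
    (hsum : Summable fun n => 1 / l n ^ 2) {s : ℝ} (hs : 0 ≤ s) (hsl : s < l 0) :
    Summable fun n => 2 * s ^ 2 / (l n ^ 2 - s ^ 2) :=
  (hsum.mul_left _).of_nonneg_of_le (term_nonneg hmono hs hsl)
    (term_le_const_div_sq hmono hpos hs le_rfl hsl)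

lemma term_lt_term {l : ℕ → ℝ} (hmono : StrictMono l) {s t : ℝ} (hs : 0 ≤ s) (hst : s < t)
    (ht : t < l 0) (n : ℕ) :
    2 * s ^ 2 / (l n ^ 2 - s ^ 2) < 2 * t ^ 2 / (l n ^ 2 - t ^ 2) := by
  have hn := sq_lt_sq_of_lt_zeroth hmono (hs.trans hst.le) ht n
  have h2 : s ^ 2 < t ^ 2 := pow_lt_pow_left₀ hst hs two_ne_zero
  exact div_lt_div₀ (by linarith) (by linarith) (by positivity) (by linarith)

lemma tsum_term_lt {l : ℕ → ℝ} (hmono : StrictMono l) (hpos : ∀ n, 0 < l n)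
    (hsum : Summable fun n => 1 / l n ^ 2) {s t : ℝ} (hs : 0 ≤ s) (hst : s < t)
    (ht : t < l 0) :
    ∑' n, 2 * s ^ 2 / (l n ^ 2 - s ^ 2) < ∑' n, 2 * t ^ 2 / (l n ^ 2 - t ^ 2) :=
  Summable.tsum_lt_tsum (i := 0) (fun n => (term_lt_term hmono hs hst ht n).le)
    (term_lt_term hmono hs hst ht 0) (summable_term hmono hpos hsum hs (hst.trans ht))
    (summable_term hmono hpos hsum (hs.trans hst.le) ht)

lemma continuousOn_tsum_term {l : ℕ → ℝ} (hmono : StrictMono l) (hpos : ∀ n, 0 < l n)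
    (hsum : Summable fun n => 1 / l n ^ 2) {b : ℝ} (hb : b < l 0) :
    ContinuousOn (fun s : ℝ => ∑' n, 2 * s ^ 2 / (l n ^ 2 - s ^ 2)) (Set.Icc 0 b) := by
  refine continuousOn_tsum (fun n => ?_)
    (hsum.mul_left (2 * b ^ 2 * l 0 ^ 2 / (l 0 ^ 2 - b ^ 2))) fun n s hs => ?_
  · refine ContinuousOn.div (by fun_prop) (by fun_prop) fun s hs => ?_
    exact (sub_pos.2 (sq_lt_sq_of_lt_zeroth hmono hs.1 (hs.2.trans_lt hb) n)).ne'
  · rw [Real.norm_of_nonneg (term_nonneg hmono hs.1 (hs.2.trans_lt hb) n)]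
    exact term_le_const_div_sq hmono hpos hs.1 hs.2 hb n

lemma exists_tsum_term_eq {l : ℕ → ℝ} (hmono : StrictMono l) (hpos : ∀ n, 0 < l n)
    (hsum : Summable fun n => 1 / l n ^ 2) {c : ℝ} (hc : 0 < c) :
    ∃ R ∈ Set.Ioo 0 (l 0), ∑' n, 2 * R ^ 2 / (l n ^ 2 - R ^ 2) = c := by
  have hl0 := hpos 0
  set b := √(c / (2 + c)) * l 0 with hb_def
  have hb0 : 0 ≤ b := by positivity
  have hb2 : b ^ 2 = c / (2 + c) * l 0 ^ 2 := by
    rw [hb_def, mul_pow, Real.sq_sqrt (by positivity)]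
  have hb : b < l 0 := by
    refine mul_lt_of_lt_one_left hl0 ?_
    rw [Real.sqrt_lt' one_pos, one_pow, div_lt_one (by positivity)]
    linarith
  have hterm : 2 * b ^ 2 / (l 0 ^ 2 - b ^ 2) = c := by
    have h := sq_lt_sq_of_lt_zeroth hmono hb0 hb 0
    rw [div_eq_iff (by linarith), hb2]
    field_simp
    ring
  have hcb : c ≤ ∑' n, 2 * b ^ 2 / (l n ^ 2 - b ^ 2) :=
    hterm.symm.le.trans ((summable_term hmono hpos hsum hb0 hb).le_tsum 0
      fun n _ => term_nonneg hmono hb0 hb n)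
  obtain ⟨R, hR, hRc⟩ := intermediate_value_Icc hb0 (continuousOn_tsum_term hmono hpos hsum hb)
    (show c ∈ Set.Icc _ _ from ⟨by simpa using hc.le, hcb⟩)
  have hRc : ∑' n, 2 * R ^ 2 / (l n ^ 2 - R ^ 2) = c := hRc
  refine ⟨R, ⟨hR.1.lt_of_ne ?_, hR.2.trans_lt hb⟩, hRc⟩
  rintro rfl
  simp at hRc
  exact hc.ne hRc

lemma sq_sub_norm_sq_le (a : ℝ) (z : ℂ) : a ^ 2 - ‖z‖ ^ 2 ≤ ‖(a : ℂ) ^ 2 - z ^ 2‖ := by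
  have h := norm_sub_norm_le ((a : ℂ) ^ 2) (z ^ 2)
  rwa [norm_pow, norm_pow, Complex.norm_real, Real.norm_eq_abs, sq_abs] at h

lemma sq_sub_sq_ne_zero_s14 {l : ℕ → ℝ} (hmono : StrictMono l) {z : ℂ} (hz : ‖z‖ < l 0) (n : ℕ) :
    (l n : ℂ) ^ 2 - z ^ 2 ≠ 0 :=
  norm_pos_iff.1 <| (sub_pos.2 (sq_lt_sq_of_lt_zeroth hmono (norm_nonneg z) hz n)).trans_le
    (sq_sub_norm_sq_le _ _)

lemma norm_complex_term_le {l : ℕ → ℝ} (hmono : StrictMono l) {z : ℂ} (hz : ‖z‖ < l 0) (n : ℕ) :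
    ‖2 * z ^ 2 / ((l n : ℂ) ^ 2 - z ^ 2)‖ ≤ 2 * ‖z‖ ^ 2 / (l n ^ 2 - ‖z‖ ^ 2) := by
  have h := sub_pos.2 (sq_lt_sq_of_lt_zeroth hmono (norm_nonneg z) hz n)
  rw [norm_div, norm_mul, norm_pow, Complex.norm_ofNat]
  exact div_le_div_of_nonneg_left (by positivity) h (sq_sub_norm_sq_le _ _)

lemma mul_logDeriv_factor {a z : ℂ} (ha : a ≠ 0) :
    z * logDeriv (fun w : ℂ => 1 - w ^ 2 / a ^ 2) z = -(2 * z ^ 2 / (a ^ 2 - z ^ 2)) := by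
  have hd : HasDerivAt (fun w : ℂ => 1 - w ^ 2 / a ^ 2) (-(2 * z / a ^ 2)) z := by
    simpa using ((hasDerivAt_pow 2 z).div_const (a ^ 2)).const_sub 1
  have hfac : 1 - z ^ 2 / a ^ 2 = (a ^ 2 - z ^ 2) / a ^ 2 := by field_simp
  rw [logDeriv_apply, hd.deriv, hfac, neg_div, div_div_div_cancel_right₀ (pow_ne_zero 2 ha)]
  ring

lemma mul_logDeriv_PsiProd {l : ℕ → ℝ} (hmono : StrictMono l) (hpos : ∀ n, 0 < l n)
    (hsum : Summable fun n => 1 / l n ^ 2) {z : ℂ} (hz : ‖z‖ < l 0) :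
    z * logDeriv (PsiProd l) z = -∑' n, 2 * z ^ 2 / ((l n : ℂ) ^ 2 - z ^ 2) := by
  rcases eq_or_ne z 0 with rfl | hz0
  · simp
  have hl : ∀ n, (l n : ℂ) ≠ 0 := fun n => Complex.ofReal_ne_zero.2 (hpos n).ne'
  have hnorm : ∀ w : ℂ, ∀ n, ‖-(w ^ 2 / (l n : ℂ) ^ 2)‖ = ‖w‖ ^ 2 * (1 / l n ^ 2) := by
    intro w n
    simp [div_eq_mul_inv]
  have hne : ∀ n, 1 - z ^ 2 / (l n : ℂ) ^ 2 ≠ 0 := fun n => by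
    rw [one_sub_div (pow_ne_zero 2 (hl n))]
    exact div_ne_zero (sq_sub_sq_ne_zero_s14 hmono hz n) (pow_ne_zero 2 (hl n))
  have hterm : ∀ n, logDeriv (fun w : ℂ => 1 - w ^ 2 / (l n : ℂ) ^ 2) z
      = z⁻¹ * -(2 * z ^ 2 / ((l n : ℂ) ^ 2 - z ^ 2)) := fun n => by
    rw [← mul_logDeriv_factor (hl n), inv_mul_cancel_left₀ hz0]
  have hsumm : Summable fun n => 2 * z ^ 2 / ((l n : ℂ) ^ 2 - z ^ 2) :=
    (summable_term hmono hpos hsum (norm_nonneg z) hz).of_norm_bounded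
      (norm_complex_term_le hmono hz)
  have hmult : MultipliableLocallyUniformlyOn
      (fun n (w : ℂ) => 1 - w ^ 2 / (l n : ℂ) ^ 2) (Metric.ball 0 (l 0)) := by
    simp only [sub_eq_add_neg]
    refine Summable.multipliableLocallyUniformlyOn_nat_one_add Metric.isOpen_ball
      (hsum.mul_left (l 0 ^ 2)) (.of_forall fun n w hw => ?_) fun n => by fun_prop
    rw [hnorm]
    have hw : ‖w‖ < l 0 := by simpa using hw
    gcongr
  have hprod : ∏' n, (1 - z ^ 2 / (l n : ℂ) ^ 2) ≠ 0 := by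
    simp only [sub_eq_add_neg] at hne ⊢
    refine tprod_one_add_ne_zero_of_summable hne ?_
    simp only [hnorm]
    exact hsum.mul_left _
  have key := logDeriv_tprod_eq_tsum (f := fun n (w : ℂ) => 1 - w ^ 2 / (l n : ℂ) ^ 2)
    Metric.isOpen_ball (show z ∈ Metric.ball 0 (l 0) by simpa using hz) hne
    (fun n => by fun_prop) (by simpa only [hterm] using hsumm.neg.mul_left z⁻¹) hmult hprod
  change logDeriv (PsiProd l) z = _ at key
  rw [key]
  simp only [hterm]
  rw [tsum_mul_left, mul_inv_cancel_left₀ hz0, tsum_neg]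

lemma norm_mul_deriv_PsiProd_div {l : ℕ → ℝ} (hmono : StrictMono l) (hpos : ∀ n, 0 < l n)
    (hsum : Summable fun n => 1 / l n ^ 2) {ν : ℝ} (hν : 0 < ν) {z : ℂ} (hz : ‖z‖ < l 0) :
    ‖z * deriv (PsiProd l) z / ((ν : ℂ) * PsiProd l z)‖ =
      (1 / ν) * ‖∑' n, 2 * z ^ 2 / ((l n : ℂ) ^ 2 - z ^ 2)‖ := by
  have h : z * deriv (PsiProd l) z / ((ν : ℂ) * PsiProd l z)
      = (ν : ℂ)⁻¹ * (z * logDeriv (PsiProd l) z) := by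
    rw [logDeriv_apply, div_eq_mul_inv, mul_inv]
    ring
  rw [h, mul_logDeriv_PsiProd hmono hpos hsum hz, norm_mul, norm_neg, norm_inv,
    Complex.norm_of_nonneg hν.le, one_div]

theorem stmt_14 (l : ℕ → ℝ) (hmono : StrictMono l) (hpos : ∀ n, 0 < l n)
    (hsum : Summable fun n => 1 / (l n) ^ 2) (ν β : ℝ) (hν : 0 < ν) (hβ : 0 < β) :
    ∃ R : ℝ, R ∈ Set.Ioo 0 (l 0) ∧
      ((1 / ν) * ∑' n : ℕ, 2 * R ^ 2 / ((l n) ^ 2 - R ^ 2) = β) ∧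
      (∀ S ∈ Set.Ioo (0 : ℝ) (l 0),
        ((1 / ν) * ∑' n : ℕ, 2 * S ^ 2 / ((l n) ^ 2 - S ^ 2) = β) → S = R) ∧
      (∀ z : ℂ, ‖z‖ < R →
        ‖z * deriv (PsiProd l) z / ((ν : ℂ) * PsiProd l z)‖ < β) ∧
      ‖(R : ℂ) * deriv (PsiProd l) R / ((ν : ℂ) * PsiProd l R)‖ = β := by
  obtain ⟨R, ⟨hR0, hRl⟩, hR⟩ := exists_tsum_term_eq hmono hpos hsum (mul_pos hν hβ)
  have hval : (1 / ν) * ∑' n : ℕ, 2 * R ^ 2 / ((l n) ^ 2 - R ^ 2) = β := by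
    rw [hR]
    field_simp
  refine ⟨R, ⟨hR0, hRl⟩, hval, fun S hS hSβ => ?_, fun z hz => ?_, ?_⟩
  · have hSR := mul_left_cancel₀ (one_div_pos.2 hν).ne' (hSβ.trans hval.symm)
    rcases lt_trichotomy S R with h | h | h
    · exact absurd hSR (tsum_term_lt hmono hpos hsum hS.1.le h hRl).ne
    · exact h
    · exact absurd hSR (tsum_term_lt hmono hpos hsum hR0.le h hS.2).ne'
  · have hzl := hz.trans hRl
    rw [norm_mul_deriv_PsiProd_div hmono hpos hsum hν hzl, ← hval]
    refine mul_lt_mul_of_pos_left ?_ (one_div_pos.2 hν)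
    exact (tsum_of_norm_bounded (summable_term hmono hpos hsum (norm_nonneg z) hzl).hasSum
      (norm_complex_term_le hmono hzl)).trans_lt
        (tsum_term_lt hmono hpos hsum (norm_nonneg z) hz hRl)
  · have hRn : ‖(R : ℂ)‖ < l 0 := by rwa [Complex.norm_of_nonneg hR0.le]
    have hcast : ∑' n, 2 * (R : ℂ) ^ 2 / ((l n : ℂ) ^ 2 - (R : ℂ) ^ 2)
        = ((∑' n, 2 * R ^ 2 / (l n ^ 2 - R ^ 2) : ℝ) : ℂ) := by
      push_cast
      rfl
    rw [norm_mul_deriv_PsiProd_div hmono hpos hsum hν hRn, hcast, Complex.norm_of_nonneg, hval]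
    exact tsum_nonneg (term_nonneg hmono hR0.le hRl)
end

section
/- (Theorem 3, case h_ν) Let β > 0. Then there is a unique R ∈ (0, λ_0²) such that Σ_{n≥0} R/(λ_n² − R) = β, and: (i) for every w ∈ ℂ with |w| < R one has |w Φ'(w)/Φ(w)| < β; (ii) at w = R one has |R Φ'(R)/Φ(R)| = β. (Since w h'(w)/h(w) − 1 = wΦ'(w)/Φ(w) for h(w) = w Φ(w), this says R is the largest radius on which the values of w h'(w)/h(w) lie in the disk {w' : |w' − 1| < β}.) -/
open Real

/-- The entire function `Φ(w) = ∏_{n≥0} (1 − w/λ_n²)`. -/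
noncomputable def PhiProd (l : ℕ → ℝ) (w : ℂ) : ℂ :=
  ∏' n : ℕ, (1 - w / ((l n : ℂ)) ^ 2)

/-- The terms `r / (a n - r)` are summable for `r` below a positive lower bound of `a`. -/
lemma summable_div_sub_of_summable_one_div {a : ℕ → ℝ} {c r : ℝ} (hc : 0 < c)
    (ha : ∀ n, c ≤ a n) (hsum : Summable fun n => 1 / a n) (hr : 0 ≤ r) (hrc : r < c) :
    Summable fun n => r / (a n - r) := by
  refine Summable.of_nonneg_of_le
    (fun n => div_nonneg hr (by linarith [ha n])) (fun n => ?_) (hsum.mul_left (r * c / (c - r)))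
  have h₁ : 0 < a n - r := by linarith [ha n]
  have h₂ : 0 < c - r := by linarith
  have h₃ : 0 < a n := hc.trans_le (ha n)
  rw [div_mul_div_comm, mul_one, div_le_div_iff₀ h₁ (by positivity)]
  nlinarith [mul_nonneg (mul_nonneg hr hr) (sub_nonneg.2 (ha n))]

lemma div_sub_le_div_sub {a r s : ℝ} (hr : 0 ≤ r) (hrs : r ≤ s) (hs : s < a) :
    r / (a - r) ≤ s / (a - s) :=
  div_le_div₀ (hr.trans hrs) hrs (by linarith) (by linarith)

lemma div_sub_lt_div_sub {a r s : ℝ} (hr : 0 ≤ r) (hrs : r < s) (hs : s < a) :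
    r / (a - r) < s / (a - s) :=
  div_lt_div₀ hrs (by linarith) (hr.trans hrs.le) (by linarith)

lemma tsum_div_sub_lt_tsum_div_sub {a : ℕ → ℝ} {c r s : ℝ} (hc : 0 < c)
    (ha : ∀ n, c ≤ a n) (hsum : Summable fun n => 1 / a n) (hr : 0 ≤ r) (hrs : r < s)
    (hs : s < c) : ∑' n, r / (a n - r) < ∑' n, s / (a n - s) :=
  Summable.tsum_lt_tsum (i := 0)
    (fun n => div_sub_le_div_sub hr hrs.le (hs.trans_le (ha n)))
    (div_sub_lt_div_sub hr hrs (hs.trans_le (ha 0)))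
    (summable_div_sub_of_summable_one_div hc ha hsum hr (hrs.trans hs))
    (summable_div_sub_of_summable_one_div hc ha hsum (hr.trans hrs.le) hs)

/-- The function `r ↦ ∑ r / (a n - r)` takes every positive value on `(0, a 0)`. -/
lemma exists_tsum_div_sub_eq {a : ℕ → ℝ} (h0 : 0 < a 0)
    (ha : ∀ n, a 0 ≤ a n) (hsum : Summable fun n => 1 / a n) {β : ℝ} (hβ : 0 < β) :
    ∃ R ∈ Set.Ioo 0 (a 0), ∑' n, R / (a n - R) = β := by
  set s := a 0 * β / (1 + β) with hs
  have hs0 : 0 < s := by positivity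
  have hsc : s < a 0 := by
    rw [hs, div_lt_iff₀ (by positivity)]; linarith
  have hsv : s / (a 0 - s) = β := by
    rw [div_eq_iff (by linarith), hs]; field_simp; ring
  have hS := summable_div_sub_of_summable_one_div h0 ha hsum hs0.le hsc
  have hcont : ContinuousOn (fun r => ∑' n, r / (a n - r)) (Set.Icc 0 s) := by
    refine continuousOn_tsum (fun n => ?_) hS (fun n r hr => ?_)
    · exact continuousOn_id.div (by fun_prop) fun r hr => by linarith [ha n, hr.2]
    · rw [Real.norm_of_nonneg (div_nonneg hr.1 (by linarith [ha n, hr.2]))]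
      exact div_sub_le_div_sub hr.1 hr.2 (hsc.trans_le (ha n))
  have hle : β ≤ ∑' n, s / (a n - s) :=
    hsv.symm.le.trans (hS.le_tsum 0 fun n _ => div_nonneg hs0.le (by linarith [ha n]))
  obtain ⟨R, hR, hRβ⟩ := intermediate_value_Icc hs0.le hcont
    (show β ∈ Set.Icc _ _ from ⟨by simpa using hβ.le, hle⟩)
  refine ⟨R, ⟨lt_of_le_of_ne hR.1 ?_, hR.2.trans_lt hsc⟩, hRβ⟩
  rintro rfl
  simp at hRβ
  exact hβ.ne hRβ

lemma norm_div_ofReal_sub_le {a : ℝ} {w : ℂ} (hw : ‖w‖ < a) :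
    ‖w / ((a : ℂ) - w)‖ ≤ ‖w‖ / (a - ‖w‖) := by
  rw [norm_div]
  have h : a - ‖w‖ ≤ ‖(a : ℂ) - w‖ := by
    simpa [abs_of_pos ((norm_nonneg w).trans_lt hw)] using norm_sub_norm_le (a : ℂ) w
  exact div_le_div_of_nonneg_left (norm_nonneg w) (by linarith) h

/-- The logarithmic derivative of `PhiProd l` in the disk `|w| < c`. -/
lemma mul_deriv_PhiProd_div {l : ℕ → ℝ} {c : ℝ} (hc : 0 < c) (hl : ∀ n, c ≤ l n ^ 2)
    (hsum : Summable fun n => 1 / l n ^ 2) {w : ℂ} (hw : ‖w‖ < c) :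
    w * deriv (PhiProd l) w / PhiProd l w = -∑' n, w / (((l n ^ 2 : ℝ) : ℂ) - w) := by
  set f : ℕ → ℂ → ℂ := fun n z => -(z / (l n : ℂ) ^ 2) with hf
  have hPhi : PhiProd l = fun z => ∏' n, (1 + f n z) := by
    funext z; simp [PhiProd, hf, sub_eq_add_neg]
  have hl0 (n : ℕ) : (l n : ℂ) ^ 2 ≠ 0 := by
    exact_mod_cast (hc.trans_le (hl n)).ne'
  have hsub (n : ℕ) : (l n : ℂ) ^ 2 - w ≠ 0 := by
    intro h
    have h' := congrArg norm (sub_eq_zero.1 h)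
    simp at h'
    linarith [hl n]
  have hfac (n : ℕ) : 1 + f n w = ((l n : ℂ) ^ 2 - w) / (l n : ℂ) ^ 2 := by
    rw [sub_div, div_self (hl0 n), sub_eq_add_neg]
  have hne (n : ℕ) : 1 + f n w ≠ 0 := by
    rw [hfac]
    exact div_ne_zero (hsub n) (hl0 n)
  have hbound : ∀ n, ∀ z ∈ Metric.ball (0 : ℂ) c, ‖f n z‖ ≤ c * (1 / l n ^ 2) := by
    intro n z hz
    have hz' : ‖z‖ < c := by simpa using hz
    have : ‖f n z‖ = ‖z‖ * (1 / l n ^ 2) := by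
      simp [hf, div_eq_mul_inv]
    rw [this]
    gcongr
  have hwc : w ∈ Metric.ball (0 : ℂ) c := by simpa using hw
  have hlog (n : ℕ) : logDeriv (fun z => 1 + f n z) w = -(1 / ((l n : ℂ) ^ 2 - w)) := by
    have hd : HasDerivAt (fun z => 1 + f n z) (-(1 / (l n : ℂ) ^ 2)) w :=
      (((hasDerivAt_id w).div_const _).neg).const_add 1
    rw [logDeriv_apply, hd.deriv, hfac, neg_div, div_div_div_cancel_right₀ (hl0 n)]
  have hnorm : Summable fun n => ‖(1 : ℂ) / ((l n : ℂ) ^ 2 - w)‖ := by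
    refine Summable.of_nonneg_of_le (fun n => norm_nonneg _) (fun n => ?_)
      (hsum.mul_left (c / (c - ‖w‖)))
    have h1 : l n ^ 2 - ‖w‖ ≤ ‖(l n : ℂ) ^ 2 - w‖ := by
      have h := norm_sub_norm_le ((l n : ℂ) ^ 2) w
      rwa [norm_pow, Complex.norm_real, Real.norm_eq_abs, sq_abs] at h
    have h2 : 0 < l n ^ 2 := hc.trans_le (hl n)
    have h3 : 0 < c - ‖w‖ := by linarith
    have h4 : 0 < ‖(l n : ℂ) ^ 2 - w‖ := norm_pos_iff.2 (hsub n)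
    rw [norm_div, norm_one, div_mul_div_comm, mul_one, div_le_div_iff₀ h4 (by positivity)]
    nlinarith [mul_nonneg (norm_nonneg w) (sub_nonneg.2 (hl n))]
  have key := logDeriv_tprod_eq_tsum (f := fun n z => 1 + f n z) Metric.isOpen_ball hwc hne
    (fun n => by fun_prop) (by simpa only [hlog] using hnorm.of_norm.neg)
    (Summable.multipliableLocallyUniformlyOn_nat_one_add Metric.isOpen_ball (hsum.mul_left c)
      (.of_forall hbound) fun n => by fun_prop)
    (tprod_one_add_ne_zero_of_summable hne <|
      Summable.of_nonneg_of_le (fun n => norm_nonneg _) (fun n => hbound n w hwc)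
        (hsum.mul_left c))
  rw [← hPhi, logDeriv_apply] at key
  rw [mul_div_assoc, key]
  simp only [hlog]
  rw [tsum_neg, mul_neg, ← tsum_mul_left]
  simp [div_eq_mul_inv]

theorem stmt_16 (l : ℕ → ℝ) (hmono : StrictMono l) (hpos : ∀ n, 0 < l n)
    (hsum : Summable fun n => 1 / (l n) ^ 2) (β : ℝ) (hβ : 0 < β) :
    ∃ R : ℝ, R ∈ Set.Ioo 0 ((l 0) ^ 2) ∧
      (∑' n : ℕ, R / ((l n) ^ 2 - R) = β) ∧
      (∀ S ∈ Set.Ioo (0 : ℝ) ((l 0) ^ 2),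
        (∑' n : ℕ, S / ((l n) ^ 2 - S) = β) → S = R) ∧
      (∀ w : ℂ, ‖w‖ < R →
        ‖w * deriv (PhiProd l) w / PhiProd l w‖ < β) ∧
      ‖(R : ℂ) * deriv (PhiProd l) R / PhiProd l R‖ = β := by
  have h0 : 0 < l 0 ^ 2 := pow_pos (hpos 0) 2
  have hl (n : ℕ) : l 0 ^ 2 ≤ l n ^ 2 :=
    pow_le_pow_left₀ (hpos 0).le (hmono.monotone (Nat.zero_le n)) 2
  obtain ⟨R, hR, hRβ⟩ := exists_tsum_div_sub_eq (a := fun n => l n ^ 2) h0 hl hsum hβ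
  refine ⟨R, hR, hRβ, fun S hS hSβ => ?_, fun w hw => ?_, ?_⟩
  · rcases lt_trichotomy S R with h | h | h
    · exact absurd (hSβ.trans hRβ.symm)
        (tsum_div_sub_lt_tsum_div_sub h0 hl hsum hS.1.le h hR.2).ne
    · exact h
    · exact absurd (hRβ.trans hSβ.symm)
        (tsum_div_sub_lt_tsum_div_sub h0 hl hsum hR.1.le h hS.2).ne
  · have hwl := hw.trans hR.2
    rw [mul_deriv_PhiProd_div h0 hl hsum hwl, norm_neg, ← hRβ]
    exact (tsum_of_norm_bounded
      (summable_div_sub_of_summable_one_div h0 hl hsum (norm_nonneg w) hwl).hasSum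
      fun n => norm_div_ofReal_sub_le (hwl.trans_le (hl n))).trans_lt
      (tsum_div_sub_lt_tsum_div_sub h0 hl hsum (norm_nonneg w) hw hR.2)
  · have hRn : ‖(R : ℂ)‖ < l 0 ^ 2 := by
      rw [Complex.norm_of_nonneg hR.1.le]; exact hR.2
    have hcast : ∑' n, (R : ℂ) / (((l n ^ 2 : ℝ) : ℂ) - R) = (β : ℂ) := by
      rw [← hRβ, Complex.ofReal_tsum]
      push_cast
      rfl
    rw [mul_deriv_PhiProd_div h0 hl hsum hRn, hcast, norm_neg, Complex.norm_of_nonneg hβ.le]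
end

section
/- (Theorem 4, case g_ν) Let β > 0. Let g(z) = z Ψ(z) and assume there is a strictly increasing sequence (δ_n)_{n≥0} of positive real numbers with Σ_{n≥0} 1/δ_n² < ∞ such that g'(z) = ∏_{n≥0} (1 − z²/δ_n²) for all z ∈ ℂ. Then there is a unique R ∈ (0, δ_0) such that Σ_{n≥0} 2R²/(δ_n² − R²) = β (equivalently, R g''(R) + β g'(R) = 0), and: (i) for every z ∈ ℂ with |z| < R one has |z g''(z)/g'(z)| < β; (ii) at z = R one has |R g''(R)/g'(R)| = β. (This says R is the 𝒞(φ)-radius of g for any Ma–Minda function φ whose image contains the disk {w : |w − 1| < β} with φ(−1) = 1 − β.) -/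
open Real

section RadiusSum

variable {δ : ℕ → ℝ}

lemma sq_lt_sq_of_mem_Ico (hm : StrictMono δ) {r : ℝ} (hr : r ∈ Set.Ico 0 (δ 0)) (n : ℕ) :
    r ^ 2 < δ n ^ 2 :=
  pow_lt_pow_left₀ (hr.2.trans_le (hm.monotone n.zero_le)) hr.1 two_ne_zero

lemma radius_term_le_radius_term {d r s : ℝ} (hr : 0 ≤ r) (hrs : r ≤ s) (hs : s ^ 2 < d ^ 2) :
    2 * r ^ 2 / (d ^ 2 - r ^ 2) ≤ 2 * s ^ 2 / (d ^ 2 - s ^ 2) := by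
  have h : r ^ 2 ≤ s ^ 2 := pow_le_pow_left₀ hr hrs 2
  exact div_le_div₀ (by positivity) (by linarith) (by linarith) (by linarith)

lemma radius_term_lt_radius_term {d r s : ℝ} (hr : 0 ≤ r) (hrs : r < s) (hs : s ^ 2 < d ^ 2) :
    2 * r ^ 2 / (d ^ 2 - r ^ 2) < 2 * s ^ 2 / (d ^ 2 - s ^ 2) := by
  have h : r ^ 2 < s ^ 2 := pow_lt_pow_left₀ hrs hr two_ne_zero
  exact div_lt_div₀ (by linarith) (by linarith) (by positivity) (by linarith)

lemma summable_radius_term (hm : StrictMono δ) (hsum : Summable fun n => 1 / δ n ^ 2)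
    {r : ℝ} (hr : r ∈ Set.Ico 0 (δ 0)) :
    Summable fun n => 2 * r ^ 2 / (δ n ^ 2 - r ^ 2) := by
  have h0 := sq_lt_sq_of_mem_Ico hm hr
  refine Summable.of_nonneg_of_le
    (fun n => div_nonneg (by positivity) (by linarith [h0 n])) (fun n => ?_)
    (hsum.mul_left (2 * r ^ 2 * (δ 0 ^ 2 / (δ 0 ^ 2 - r ^ 2))))
  have hd : δ 0 ^ 2 ≤ δ n ^ 2 :=
    pow_le_pow_left₀ (hr.1.trans hr.2.le) (hm.monotone n.zero_le) 2
  have h1 : 0 < δ 0 ^ 2 - r ^ 2 := by linarith [h0 0]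
  have h2 : 0 < δ n ^ 2 - r ^ 2 := by linarith [h0 n]
  have h3 : 0 < δ n ^ 2 := (sq_nonneg r).trans_lt (h0 n)
  rw [mul_assoc, div_eq_mul_one_div (2 * r ^ 2)]
  refine mul_le_mul_of_nonneg_left ?_ (by positivity)
  rw [div_mul_div_comm, mul_one, div_le_div_iff₀ h2 (by positivity)]
  nlinarith [mul_le_mul_of_nonneg_right hd (sq_nonneg r)]

lemma strictMonoOn_radius_sum (hm : StrictMono δ) (hsum : Summable fun n => 1 / δ n ^ 2) :
    StrictMonoOn (fun r => ∑' n, 2 * r ^ 2 / (δ n ^ 2 - r ^ 2)) (Set.Ico 0 (δ 0)) :=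
  fun _ hr _ hs hrs => (summable_radius_term hm hsum hr).tsum_lt_tsum (i := 0)
    (fun n => radius_term_le_radius_term hr.1 hrs.le (sq_lt_sq_of_mem_Ico hm hs n))
    (radius_term_lt_radius_term hr.1 hrs (sq_lt_sq_of_mem_Ico hm hs 0))
    (summable_radius_term hm hsum hs)

lemma continuousOn_radius_sum (hm : StrictMono δ) (hsum : Summable fun n => 1 / δ n ^ 2)
    {a : ℝ} (ha : a ∈ Set.Ico 0 (δ 0)) :
    ContinuousOn (fun r => ∑' n, 2 * r ^ 2 / (δ n ^ 2 - r ^ 2)) (Set.Icc 0 a) := by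
  have hlt : ∀ n, ∀ x ∈ Set.Icc 0 a, x ^ 2 < δ n ^ 2 := fun n x hx =>
    sq_lt_sq_of_mem_Ico hm ⟨hx.1, hx.2.trans_lt ha.2⟩ n
  refine continuousOn_tsum (fun n => ?_) (summable_radius_term hm hsum ha) fun n x hx => ?_
  · exact ContinuousOn.div (by fun_prop) (by fun_prop) fun x hx => by linarith [hlt n x hx]
  · rw [Real.norm_of_nonneg (div_nonneg (by positivity) (by linarith [hlt n x hx]))]
    exact radius_term_le_radius_term hx.1 hx.2 (sq_lt_sq_of_mem_Ico hm ha n)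

lemma exists_radius_sum_eq (hm : StrictMono δ) (h0 : 0 < δ 0)
    (hsum : Summable fun n => 1 / δ n ^ 2) {β : ℝ} (hβ : 0 < β) :
    ∃ R ∈ Set.Ioo 0 (δ 0), ∑' n, 2 * R ^ 2 / (δ n ^ 2 - R ^ 2) = β := by
  have hq : β / (2 + β) < 1 := (div_lt_one (by positivity)).2 (by linarith)
  set a := δ 0 * √(β / (2 + β)) with ha_def
  have ha : a ∈ Set.Ico 0 (δ 0) :=
    ⟨by positivity, mul_lt_of_lt_one_right h0 ((Real.sqrt_lt' one_pos).2 (by simpa using hq))⟩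
  have hasq : a ^ 2 = δ 0 ^ 2 * (β / (2 + β)) := by
    rw [ha_def, mul_pow, Real.sq_sqrt (by positivity)]
  have hterm : 2 * a ^ 2 / (δ 0 ^ 2 - a ^ 2) = β := by
    rw [div_eq_iff (by linarith [sq_lt_sq_of_mem_Ico hm ha 0]), hasq]
    field_simp
    ring
  have hle : β ≤ ∑' n, 2 * a ^ 2 / (δ n ^ 2 - a ^ 2) := by
    conv_lhs => rw [← hterm]
    exact (summable_radius_term hm hsum ha).le_tsum 0 fun n _ =>
      div_nonneg (by positivity) (by linarith [sq_lt_sq_of_mem_Ico hm ha n])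
  obtain ⟨R, hR, hRβ⟩ := intermediate_value_Icc ha.1 (continuousOn_radius_sum hm hsum ha)
    ⟨by simpa using hβ.le, hle⟩
  refine ⟨R, ⟨hR.1.lt_of_ne ?_, hR.2.trans_lt ha.2⟩, hRβ⟩
  rintro rfl
  simp at hRβ
  exact hβ.ne hRβ

lemma norm_radius_term_le {d : ℝ} {z : ℂ} (hz : ‖z‖ ^ 2 < d ^ 2) :
    ‖2 * z ^ 2 / ((d : ℂ) ^ 2 - z ^ 2)‖ ≤ 2 * ‖z‖ ^ 2 / (d ^ 2 - ‖z‖ ^ 2) := by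
  rw [norm_div, norm_mul, norm_pow, Complex.norm_ofNat]
  refine div_le_div_of_nonneg_left (by positivity) (by linarith) ?_
  have hd : ‖(d : ℂ) ^ 2‖ = d ^ 2 := by
    rw [norm_pow, Complex.norm_real, Real.norm_eq_abs, sq_abs]
  rw [← hd, ← norm_pow z]
  exact norm_sub_norm_le _ _

lemma mul_logDeriv_tprod_one_sub_sq (hm : StrictMono δ) (h0 : 0 < δ 0)
    (hsum : Summable fun n => 1 / δ n ^ 2) {z : ℂ} (hz : ‖z‖ < δ 0) :
    z * logDeriv (fun w => ∏' n, (1 - w ^ 2 / (δ n : ℂ) ^ 2)) z =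
      -∑' n, 2 * z ^ 2 / ((δ n : ℂ) ^ 2 - z ^ 2) := by
  have hzI : ‖z‖ ∈ Set.Ico 0 (δ 0) := ⟨norm_nonneg z, hz⟩
  have hlt := sq_lt_sq_of_mem_Ico hm hzI
  have hδ : ∀ n, (δ n : ℂ) ≠ 0 := fun n =>
    Complex.ofReal_ne_zero.2 (h0.trans_le (hm.monotone n.zero_le)).ne'
  have hsub : ∀ n, (δ n : ℂ) ^ 2 - z ^ 2 ≠ 0 := fun n h => by
    have := congrArg norm (sub_eq_zero.1 h)
    simp only [norm_pow, Complex.norm_real, Real.norm_eq_abs, sq_abs] at this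
    linarith [hlt n]
  have hne : ∀ n, 1 - z ^ 2 / (δ n : ℂ) ^ 2 ≠ 0 := fun n => by
    rw [one_sub_div (pow_ne_zero 2 (hδ n))]
    exact div_ne_zero (hsub n) (pow_ne_zero 2 (hδ n))
  have hnorm : ∀ n (w : ℂ), ‖-(w ^ 2 / (δ n : ℂ) ^ 2)‖ = ‖w‖ ^ 2 * (1 / δ n ^ 2) := fun n w => by
    rw [norm_neg, norm_div, norm_pow, norm_pow, Complex.norm_real, Real.norm_eq_abs, sq_abs,
      div_eq_mul_one_div]
  have hlog : ∀ n, z * logDeriv (fun w : ℂ => 1 - w ^ 2 / (δ n : ℂ) ^ 2) z =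
      -(2 * z ^ 2 / ((δ n : ℂ) ^ 2 - z ^ 2)) := fun n => by
    have hd : HasDerivAt (fun w : ℂ => 1 - w ^ 2 / (δ n : ℂ) ^ 2) (-(2 * z / (δ n : ℂ) ^ 2)) z := by
      simpa using ((hasDerivAt_pow 2 z).div_const ((δ n : ℂ) ^ 2)).const_sub 1
    rw [logDeriv_apply, hd.deriv, one_sub_div (pow_ne_zero 2 (hδ n))]
    have := hsub n
    have := hδ n
    field_simp
  have hsumz : Summable fun n => 2 * z ^ 2 / ((δ n : ℂ) ^ 2 - z ^ 2) :=
    .of_norm_bounded (summable_radius_term hm hsum hzI) fun n => norm_radius_term_le (hlt n)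
  have hsumlog : Summable fun n => logDeriv (fun w : ℂ => 1 - w ^ 2 / (δ n : ℂ) ^ 2) z := by
    rcases eq_or_ne z 0 with rfl | hz0
    · simp [logDeriv_apply]
    · exact (summable_mul_left_iff hz0).1 (hsumz.neg.congr fun n => (hlog n).symm)
  have hunif : MultipliableLocallyUniformlyOn (fun n (w : ℂ) => 1 - w ^ 2 / (δ n : ℂ) ^ 2)
      (Metric.ball 0 (δ 0)) := by
    simp only [sub_eq_add_neg]
    refine Summable.multipliableLocallyUniformlyOn_nat_one_add Metric.isOpen_ball
      (hsum.mul_left (δ 0 ^ 2)) (.of_forall fun n w hw => ?_) fun n => by fun_prop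
    rw [hnorm]
    have hw' : ‖w‖ ≤ δ 0 := (mem_ball_zero_iff.1 hw).le
    gcongr
  have hprod : ∏' n, (1 - z ^ 2 / (δ n : ℂ) ^ 2) ≠ 0 := by
    simp only [sub_eq_add_neg] at hne ⊢
    exact tprod_one_add_ne_zero_of_summable hne (by simpa only [hnorm] using hsum.mul_left _)
  rw [logDeriv_tprod_eq_tsum Metric.isOpen_ball (mem_ball_zero_iff.2 hz) hne
    (fun n => by fun_prop) hsumlog hunif hprod, ← tsum_mul_left, ← tsum_neg]
  exact tsum_congr hlog

end RadiusSum

theorem stmt_17 (l : ℕ → ℝ) (hmono : StrictMono l) (hpos : ∀ n, 0 < l n)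
    (hsum : Summable fun n => 1 / (l n) ^ 2) (β : ℝ) (hβ : 0 < β)
    (g : ℂ → ℂ) (hg : ∀ z : ℂ, g z = z * PsiProd l z)
    (δ : ℕ → ℝ) (hδmono : StrictMono δ) (hδpos : ∀ n, 0 < δ n)
    (hδsum : Summable fun n => 1 / (δ n) ^ 2)
    (hg' : ∀ z : ℂ, deriv g z = ∏' n : ℕ, (1 - z ^ 2 / ((δ n : ℂ)) ^ 2)) :
    ∃ R : ℝ, R ∈ Set.Ioo 0 (δ 0) ∧
      (∑' n : ℕ, 2 * R ^ 2 / ((δ n) ^ 2 - R ^ 2) = β) ∧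
      (∀ S ∈ Set.Ioo (0 : ℝ) (δ 0),
        (∑' n : ℕ, 2 * S ^ 2 / ((δ n) ^ 2 - S ^ 2) = β) → S = R) ∧
      (∀ z : ℂ, ‖z‖ < R →
        ‖z * deriv (deriv g) z / deriv g z‖ < β) ∧
      ‖(R : ℂ) * deriv (deriv g) R / deriv g R‖ = β := by
  obtain ⟨R, hR, hRβ⟩ := exists_radius_sum_eq hδmono (hδpos 0) hδsum hβ
  have hmonoOn := strictMonoOn_radius_sum hδmono hδsum
  have hformula : ∀ z : ℂ, ‖z‖ < δ 0 → z * deriv (deriv g) z / deriv g z =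
      -∑' n, 2 * z ^ 2 / ((δ n : ℂ) ^ 2 - z ^ 2) := fun z hz => by
    rw [← mul_logDeriv_tprod_one_sub_sq hδmono (hδpos 0) hδsum hz, ← funext hg', logDeriv_apply,
      mul_div_assoc]
  refine ⟨R, hR, hRβ, fun S hS hSβ => ?_, fun z hz => ?_, ?_⟩
  · exact hmonoOn.injOn ⟨hS.1.le, hS.2⟩ ⟨hR.1.le, hR.2⟩ (hSβ.trans hRβ.symm)
  · have hzI : ‖z‖ ∈ Set.Ico 0 (δ 0) := ⟨norm_nonneg z, hz.trans hR.2⟩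
    rw [hformula z hzI.2, norm_neg, ← hRβ]
    exact (tsum_of_norm_bounded (summable_radius_term hδmono hδsum hzI).hasSum fun n =>
      norm_radius_term_le (sq_lt_sq_of_mem_Ico hδmono hzI n)).trans_lt
        (hmonoOn hzI ⟨hR.1.le, hR.2⟩ hz)
  · have hnorm : ‖(R : ℂ)‖ < δ 0 := by
      rw [Complex.norm_real, Real.norm_of_nonneg hR.1.le]
      exact hR.2
    have hcast : ∑' n, 2 * (R : ℂ) ^ 2 / ((δ n : ℂ) ^ 2 - (R : ℂ) ^ 2) = (β : ℂ) := by
      rw [← hRβ]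
      push_cast
      rfl
    rw [hformula R hnorm, hcast, norm_neg, Complex.norm_real, Real.norm_of_nonneg hβ.le]
end

section
/- The open disk {w ∈ ℂ : |w − 1| < 1 − e^{−1}} is contained in the image exp(𝔻) of the open unit disk 𝔻 = {z ∈ ℂ : |z| < 1} under the complex exponential, and this radius is largest possible: for every β > 1 − e^{−1} there exists w ∈ ℂ with |w − 1| < β such that w ≠ exp(z) for all z with |z| < 1. -/
/-- The modulus of `log (1 - z)` is dominated by the Taylor series at `‖z‖`. -/
theorem Complex.norm_log_one_sub_le_neg_log {z : ℂ} (hz : ‖z‖ < 1) :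
    ‖Complex.log (1 - z)‖ ≤ -Real.log (1 - ‖z‖) := by
  have hc := Complex.hasSum_taylorSeries_neg_log hz
  have hr : HasSum (fun n : ℕ => ‖z‖ ^ n / n) (-Real.log (1 - ‖z‖)) := by
    rw [← hasSum_nat_add_iff' 1]
    simpa using Real.hasSum_pow_div_log_of_abs_lt_one (x := ‖z‖) (by simpa using hz)
  rw [← norm_neg, ← hc.tsum_eq]
  exact tsum_of_norm_bounded hr fun n => by simp

theorem stmt_19 :
    (Metric.ball (1 : ℂ) (1 - Real.exp (-1)) ⊆ Complex.exp '' Metric.ball (0 : ℂ) 1) ∧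
    ∀ β : ℝ, 1 - Real.exp (-1) < β →
      ∃ w : ℂ, ‖w - 1‖ < β ∧ ∀ z : ℂ, ‖z‖ < 1 → Complex.exp z ≠ w := by
  have hpos := Real.exp_pos (-1)
  refine ⟨fun w hw => ?_, fun β hβ => ⟨(Real.exp (-1) : ℂ), ?_, fun z hz h => ?_⟩⟩
  · rw [mem_ball_iff_norm, norm_sub_rev] at hw
    have hlt : ‖1 - w‖ < 1 := by linarith
    have hw0 : w ≠ 0 := by
      rintro rfl
      simp at hlt
    refine ⟨Complex.log w, ?_, Complex.exp_log hw0⟩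
    have hle := Complex.norm_log_one_sub_le_neg_log hlt
    rw [sub_sub_cancel] at hle
    have hlog : -1 < Real.log (1 - ‖1 - w‖) :=
      (Real.lt_log_iff_exp_lt (by linarith)).2 (by linarith)
    rw [mem_ball_zero_iff]
    linarith
  · have hle : Real.exp (-1) ≤ 1 := Real.exp_le_one_iff.2 (by norm_num)
    rw [← Complex.ofReal_one, ← Complex.ofReal_sub, Complex.norm_real, Real.norm_eq_abs,
      abs_sub_comm, abs_of_nonneg (by linarith)]
    exact hβ
  · have hnorm := congrArg norm h
    rw [Complex.norm_exp, Complex.norm_real, Real.norm_of_nonneg hpos.le, Real.exp_eq_exp] at hnorm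
    have hre := Complex.abs_re_le_norm z
    rw [hnorm] at hre
    norm_num at hre
    linarith
end
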